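/- arXiv:2410.23431 — 3 statements merged into one kernel-verified Lean document; each statement's English description precedes it below -/
import Mathlib

section
/- Let M be an unbounded graph matroid family. Then M has the Whitney property if and only if M has the Lovász-Yemini property. -/
/-!
Common framework: graph matroid families.

A finite simple graph (without isolated vertices) is identified with its edge
set: a finite set of non-diagonal elements of `Sym2 ℕ`.  A graph matroid
family is encoded, following the paper, as a finitary matroid on the edge set
of the countable complete graph on `ℕ` that is invariant under all
permutations of `ℕ`.
-/

/-- The set of vertices covered by a set of edges. -/
def eSupp (E : Set (Sym2 ℕ)) : Set ℕ := {v : ℕ | ∃ e ∈ E, v ∈ e}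

/-- The edge set of the complete graph on the vertex set `V`. -/
def clique (V : Set ℕ) : Set (Sym2 ℕ) := {e : Sym2 ℕ | ¬ e.IsDiag ∧ ∀ v ∈ e, v ∈ V}

/-- The edge set of the complete graph `K_n` on the vertices `0, …, n-1`. -/
def cliqueN (n : ℕ) : Set (Sym2 ℕ) := clique {v : ℕ | v < n}

/-- `E` is (the edge set of) a finite simple graph. -/
def IsGraph (E : Set (Sym2 ℕ)) : Prop := E.Finite ∧ ∀ e ∈ E, ¬ e.IsDiag

/-- The degree of the vertex `v` in the edge set `E`. -/
noncomputable def deg (E : Set (Sym2 ℕ)) (v : ℕ) : ℕ := {e ∈ E | v ∈ e}.ncard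

/-- The minimum degree of (the graph with) edge set `E` (whose vertex set is `eSupp E`). -/
noncomputable def minDeg (E : Set (Sym2 ℕ)) : ℕ := sInf {k : ℕ | ∃ v ∈ eSupp E, deg E v = k}

/-- Deleting a set `S` of vertices from the graph with edge set `E`. -/
def deleteVerts (E : Set (Sym2 ℕ)) (S : Set ℕ) : Set (Sym2 ℕ) := {e ∈ E | ∀ v ∈ e, v ∉ S}

/-- The graph with edge set `E` is `k`-connected: it has more than `k` vertices and
deleting any set of fewer than `k` vertices leaves a connected graph. -/
def KConnected (k : ℕ) (E : Set (Sym2 ℕ)) : Prop :=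
  k < (eSupp E).ncard ∧
  ∀ S : Finset ℕ, S.card < k →
    ((SimpleGraph.fromEdgeSet E).induce (eSupp E \ ↑S)).Connected

/-- `E` is a forest. -/
def IsForest (E : Set (Sym2 ℕ)) : Prop := (SimpleGraph.fromEdgeSet E).IsAcyclic

/-- `E` is a matching: no two distinct edges of `E` share a vertex. -/
def IsMatching (E : Set (Sym2 ℕ)) : Prop :=
  ∀ e ∈ E, ∀ f ∈ E, e ≠ f → ∀ v : ℕ, v ∈ e → v ∉ f

/-- `E` is a star `K_{1,m}` with `m` edges. -/
def IsStar (m : ℕ) (E : Set (Sym2 ℕ)) : Prop :=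
  ∃ (c : ℕ) (L : Finset ℕ), c ∉ L ∧ L.card = m ∧ E = (fun x => s(c, x)) '' ↑L

/-- `C` is a cycle graph `C_n` for some `n ≥ 3`. -/
def IsCycleGraph (C : Set (Sym2 ℕ)) : Prop :=
  ∃ n : ℕ, 3 ≤ n ∧ ∃ f : ZMod n → ℕ, Function.Injective f ∧
    C = {e : Sym2 ℕ | ∃ i : ZMod n, e = s(f i, f (i + 1))}

/-- The rank of the set `X` in the matroid `M₀`: the supremum of the cardinalities of
independent subsets of `X` (as a natural number; all sets we use are finite). -/
noncomputable def mrk (M₀ : Matroid (Sym2 ℕ)) (X : Set (Sym2 ℕ)) : ℕ :=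
  sSup {n : ℕ | ∃ I ⊆ X, M₀.Indep I ∧ I.ncard = n}

/-- A vertical `k`-separation of the matroid `M₀`. -/
def VerticalSep (M₀ : Matroid (Sym2 ℕ)) (k : ℕ) (E₁ E₂ : Set (Sym2 ℕ)) : Prop :=
  Disjoint E₁ E₂ ∧ E₁ ∪ E₂ = M₀.E ∧
  k ≤ mrk M₀ E₁ ∧ k ≤ mrk M₀ E₂ ∧
  mrk M₀ E₁ + mrk M₀ E₂ + 1 ≤ mrk M₀ M₀.E + k

/-- The matroid `M₀` is vertically `k`-connected. -/
def VerticallyConnected (M₀ : Matroid (Sym2 ℕ)) (k : ℕ) : Prop :=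
  k ≤ mrk M₀ M₀.E ∧
  ∀ k' : ℕ, 0 < k' → k' < k → ∀ E₁ E₂ : Set (Sym2 ℕ), ¬ VerticalSep M₀ k' E₁ E₂

/-- A `d`-dimensional abstract rigidity matroid on the complete graph with vertex set `V`. -/
def IsARM (d : ℕ) (V : Set ℕ) (M₀ : Matroid (Sym2 ℕ)) : Prop :=
  M₀.E = clique V ∧
  (∀ E₁ E₂ : Set (Sym2 ℕ), E₁ ⊆ clique V → E₂ ⊆ clique V →
      (eSupp E₁ ∩ eSupp E₂).ncard < d →
      M₀.closure (E₁ ∪ E₂) = M₀.closure E₁ ∪ M₀.closure E₂) ∧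
  (∀ E₁ E₂ : Set (Sym2 ℕ), E₁ ⊆ clique V → E₂ ⊆ clique V →
      d ≤ (eSupp E₁ ∩ eSupp E₂).ncard →
      M₀.closure E₁ = clique (eSupp E₁) → M₀.closure E₂ = clique (eSupp E₂) →
      M₀.closure (E₁ ∪ E₂) = clique (eSupp E₁ ∪ eSupp E₂))

/-- The `d`-dimensional edge split operation: replace an edge `uv` of `G` by a new
vertex `w` joined to `u` and `v`, as well as to `d - 1` other vertices of `G`. -/
def EdgeSplit (d : ℕ) (G G' : Set (Sym2 ℕ)) : Prop :=
  ∃ (u v w : ℕ) (X : Finset ℕ),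
    s(u, v) ∈ G ∧ w ∉ eSupp G ∧ ↑X ⊆ eSupp G ∧ X.card = d - 1 ∧ u ∉ X ∧ v ∉ X ∧
    G' = (G \ {s(u, v)}) ∪ {s(w, u), s(w, v)} ∪ ((fun x => s(w, x)) '' ↑X)

/-- A graph matroid family: a finitary matroid on the edge set of the countable
complete graph on `ℕ`, invariant under all permutations of `ℕ`. -/
structure GraphMatroidFamily where
  /-- The underlying matroid on the edge set of `K_ℕ`. -/
  M : Matroid (Sym2 ℕ)
  ground_eq : M.E = {e : Sym2 ℕ | ¬ e.IsDiag}
  finitary : M.Finitary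
  invariant : ∀ σ : Equiv.Perm ℕ, ∀ I : Set (Sym2 ℕ),
    M.Indep I → M.Indep (Sym2.map σ '' I)

namespace GraphMatroidFamily

variable (M : GraphMatroidFamily)

/-- The rank function of the family: `M.rk E` is the rank of the matroid `M(G)` for
any graph `G` whose edge set contains `E`. -/
noncomputable def rk (E : Set (Sym2 ℕ)) : ℕ := mrk M.M E

/-- A set of edges (a graph) is `M`-independent. -/
def Indep (E : Set (Sym2 ℕ)) : Prop := M.M.Indep E

/-- `C` is an `M`-circuit: a graph that is not `M`-independent, but such that deleting
any single edge from it yields an `M`-independent graph. -/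
def IsCircuit (C : Set (Sym2 ℕ)) : Prop :=
  IsGraph C ∧ ¬ M.Indep C ∧ ∀ e ∈ C, M.Indep (C \ {e})

/-- The graph with edge set `E` is `M`-rigid. -/
def Rigid (E : Set (Sym2 ℕ)) : Prop := M.rk E = M.rk (clique (eSupp E))

/-- The graph with vertex set `V` and edge set `E` is `M`-rigid. -/
def RigidOn (V : Set ℕ) (E : Set (Sym2 ℕ)) : Prop := M.rk E = M.rk (clique V)

/-- `M` is trivial if every (finite, simple) graph is `M`-independent. -/
def Trivial : Prop := ∀ E : Set (Sym2 ℕ), IsGraph E → M.Indep E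

/-- `M` is unbounded: the sequence `r(K_n)` is unbounded. -/
def Unbounded : Prop := ∀ B : ℕ, ∃ n : ℕ, B < M.rk (cliqueN n)

/-- `M` is bounded: the sequence `r(K_n)` is bounded. -/
def Bounded : Prop := ∃ B : ℕ, ∀ n : ℕ, M.rk (cliqueN n) ≤ B

/-- For a bounded family, `m` is the rank `r(M)` of `M`: the maximum (limit) of the
monotone sequence `r(K_n)`. -/
def HasRank (m : ℕ) : Prop :=
  (∀ n : ℕ, M.rk (cliqueN n) ≤ m) ∧ ∃ n : ℕ, M.rk (cliqueN n) = m

/-- `d` is the dimensionality of (the nontrivial family) `M`: the least `d` such that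
there is an `M`-circuit with minimum degree `d + 1`. -/
def IsDimensionality (d : ℕ) : Prop :=
  IsLeast {d : ℕ | ∃ C, M.IsCircuit C ∧ minDeg C = d + 1} d

/-- `t` is the threshold of (the nontrivial family) `M` with dimensionality `d`:
the least value of `|V(C)| - 1` over all `M`-circuits `C` with minimum degree `d + 1`. -/
def IsThreshold (d t : ℕ) : Prop :=
  IsLeast {t : ℕ | ∃ C, M.IsCircuit C ∧ minDeg C = d + 1 ∧ (eSupp C).ncard = t + 1} t

/-- `M` has the Lovász–Yemini property. -/
def LovaszYemini : Prop :=
  ∃ c : ℕ, ∀ E : Set (Sym2 ℕ), IsGraph E → KConnected c E → M.Rigid E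

/-- `ψ` is an isomorphism between the matroids `M(G)` and `M(H)`. -/
def MatroidIso (G H : Set (Sym2 ℕ)) (ψ : Sym2 ℕ → Sym2 ℕ) : Prop :=
  Set.BijOn ψ G H ∧ ∀ S ⊆ G, (M.Indep S ↔ M.Indep (ψ '' S))

/-- `G` is `M`-reconstructible: every isomorphism between `M(G)` and `M(H)` (for a graph
`H` without isolated vertices) is induced by a graph isomorphism. -/
def Reconstructible (G : Set (Sym2 ℕ)) : Prop :=
  ∀ H : Set (Sym2 ℕ), IsGraph H → ∀ ψ : Sym2 ℕ → Sym2 ℕ, M.MatroidIso G H ψ →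
    ∃ φ : ℕ → ℕ, Set.BijOn φ (eSupp G) (eSupp H) ∧ ∀ e ∈ G, ψ e = Sym2.map φ e

/-- `M` has the Whitney property. -/
def Whitney : Prop :=
  ∃ c : ℕ, ∀ E : Set (Sym2 ℕ), IsGraph E → KConnected c E → M.Reconstructible E

/-- `M` is the union of the graph matroid families `Ms`. -/
def IsUnionOf {k : ℕ} (Ms : Fin k → GraphMatroidFamily) : Prop :=
  ∀ I : Set (Sym2 ℕ),
    M.Indep I ↔ ∃ Is : Fin k → Set (Sym2 ℕ), (∀ i, (Ms i).Indep (Is i)) ∧ I = ⋃ i, Is i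

/-- `M` is a family of `d`-dimensional abstract rigidity matroids. -/
def FamilyOfARM (d : ℕ) : Prop :=
  ∀ n : ℕ, d ≤ n → IsARM d {v : ℕ | v < n} (M.M.restrict (cliqueN n))

/-- `M` is `1`-extendable: its dimensionality `d` is finite and positive, and the
`d`-dimensional edge split operation preserves `M`-independence. -/
def OneExtendable : Prop :=
  ∃ d : ℕ, 0 < d ∧ M.IsDimensionality d ∧
    ∀ G G' : Set (Sym2 ℕ), IsGraph G → M.Indep G → EdgeSplit d G G' → M.Indep G'

/-- `G` is `k`-vertex-redundantly `M`-rigid. -/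
def VertexRedundantlyRigid (k : ℕ) (G : Set (Sym2 ℕ)) : Prop :=
  M.Rigid G ∧ ∀ S : Finset ℕ, ↑S ⊆ eSupp G → S.card ≤ k →
    M.RigidOn (eSupp G \ ↑S) (deleteVerts G ↑S)

end GraphMatroidFamily

namespace GraphMatroidFamily
open Set

variable {M : GraphMatroidFamily}

theorem cast_rk {X : Set (Sym2 ℕ)} (hX : X.Finite) : (M.rk X : ℕ∞) = M.M.eRk X := by
  have hbdd : BddAbove {n : ℕ | ∃ I ⊆ X, M.M.Indep I ∧ I.ncard = n} := by
    refine ⟨X.ncard, ?_⟩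
    rintro n ⟨I, hI, -, rfl⟩
    exact Set.ncard_le_ncard hI hX
  have hne : {n : ℕ | ∃ I ⊆ X, M.M.Indep I ∧ I.ncard = n}.Nonempty :=
    ⟨0, ∅, by simp, M.M.empty_indep, by simp⟩
  apply le_antisymm
  · obtain ⟨I, hIX, hI, hn⟩ := Nat.sSup_mem hne hbdd
    have : M.rk X = I.ncard := hn.symm
    rw [this, (hX.subset hIX).cast_ncard_eq]
    exact hI.encard_le_eRk_of_subset hIX
  · rw [Matroid.eRk_le_iff]
    intro I hIX hI
    rw [← (hX.subset hIX).cast_ncard_eq]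
    exact_mod_cast le_csSup hbdd ⟨I, hIX, hI, rfl⟩

theorem rk_mono {X Y : Set (Sym2 ℕ)} (hY : Y.Finite) (h : X ⊆ Y) : M.rk X ≤ M.rk Y := by
  have := M.M.eRk_mono h
  rw [← cast_rk hY, ← cast_rk (hY.subset h)] at this
  exact_mod_cast this

theorem rk_submod {X Y : Set (Sym2 ℕ)} (hX : X.Finite) (hY : Y.Finite) :
    M.rk (X ∩ Y) + M.rk (X ∪ Y) ≤ M.rk X + M.rk Y := by
  have := M.M.eRk_inter_add_eRk_union_le X Y
  rw [← cast_rk hX, ← cast_rk hY, ← cast_rk (hX.union hY), ← cast_rk (hX.inter_of_left _)] at this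
  exact_mod_cast this

theorem rk_union_le {X Y : Set (Sym2 ℕ)} (hX : X.Finite) (hY : Y.Finite) :
    M.rk (X ∪ Y) ≤ M.rk X + M.rk Y := by
  have := rk_submod (M := M) hX hY
  omega

theorem rk_le_ncard {X : Set (Sym2 ℕ)} (hX : X.Finite) : M.rk X ≤ X.ncard := by
  have := M.M.eRk_le_encard X
  rw [← cast_rk hX, ← hX.cast_ncard_eq] at this
  exact_mod_cast this

theorem rk_closure_le {X Y : Set (Sym2 ℕ)} (hX : X.Finite) (hY : Y.Finite)
    (h : Y ⊆ M.M.closure X) : M.rk Y ≤ M.rk X := by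
  have := M.M.eRk_mono h
  rw [Matroid.eRk_closure_eq, ← cast_rk hX, ← cast_rk hY] at this
  exact_mod_cast this

theorem rk_insert {X : Set (Sym2 ℕ)} {e : Sym2 ℕ} (hX : X.Finite) (he : ¬ e.IsDiag)
    (h : e ∉ M.M.closure X) : M.rk (insert e X) = M.rk X + 1 := by
  have := Matroid.eRk_insert_eq_add_one (M := M.M) (e := e) (X := X)
    ⟨by rw [M.ground_eq]; exact he, h⟩
  rw [← cast_rk hX, ← cast_rk (hX.insert e)] at this
  exact_mod_cast this

theorem subset_closure_of_rk {X Y : Set (Sym2 ℕ)} (hY : Y.Finite) (hYd : ∀ e ∈ Y, ¬ e.IsDiag)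
    (hXY : X ⊆ Y) (h : M.rk Y ≤ M.rk X) : Y ⊆ M.M.closure X := by
  intro e he
  by_contra hcon
  have h1 := rk_insert (hY.subset hXY) (hYd e he) hcon
  have h2 := rk_mono (M := M) hY (insert_subset he hXY)
  omega

theorem lam_mono {A B A' B' : Set (Sym2 ℕ)} (hA' : A'.Finite) (hB' : B'.Finite)
    (hA : A ⊆ A') (hB : B ⊆ B') :
    M.rk A + M.rk B + M.rk (A' ∪ B') ≤ M.rk A' + M.rk B' + M.rk (A ∪ B) := by
  have h1 := rk_submod (M := M) hA' ((hA'.subset hA).union (hB'.subset hB))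
  have h2 := rk_submod (M := M) hB' (hA'.union (hB'.subset hB))
  have e1 : M.rk A ≤ M.rk (A' ∩ (A ∪ B)) :=
    rk_mono (hA'.inter_of_left _) (fun x hx => ⟨hA hx, Or.inl hx⟩)
  have e2 : M.rk B ≤ M.rk (B' ∩ (A' ∪ B)) :=
    rk_mono (hB'.inter_of_left _) (fun x hx => ⟨hB hx, Or.inr hx⟩)
  have e3 : A' ∪ (A ∪ B) = A' ∪ B := by
    rw [← union_assoc, union_eq_left.mpr hA]
  have e4 : B' ∪ (A' ∪ B) = A' ∪ B' := by
    ext x; simp only [mem_union]; constructor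
    · rintro (h | h | h)
      exacts [Or.inr h, Or.inl h, Or.inr (hB h)]
    · tauto
  rw [e3] at h1
  rw [e4] at h2
  omega

/-! ### Invariance -/

theorem indep_map_iff (σ : Equiv.Perm ℕ) (I : Set (Sym2 ℕ)) :
    M.M.Indep (Sym2.map σ '' I) ↔ M.M.Indep I := by
  refine ⟨fun h => ?_, M.invariant σ I⟩
  have := M.invariant σ⁻¹ _ h
  rw [image_image] at this
  have h2 : (fun x => Sym2.map (σ⁻¹ : Equiv.Perm ℕ) (Sym2.map σ x)) '' I = I := by
    have : (fun x : Sym2 ℕ => Sym2.map (σ⁻¹ : Equiv.Perm ℕ) (Sym2.map σ x)) = id := by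
      funext x
      rw [Sym2.map_map]
      have : (⇑σ⁻¹ ∘ ⇑σ : ℕ → ℕ) = id := by funext y; simp
      rw [this]; simp
    rw [this, image_id]
  rwa [h2] at this

theorem rk_iso {G : Set (Sym2 ℕ)} {ψ : Sym2 ℕ → Sym2 ℕ} (hinj : InjOn ψ G)
    (hψ : ∀ S ⊆ G, (M.M.Indep S ↔ M.M.Indep (ψ '' S))) {S : Set (Sym2 ℕ)} (hS : S ⊆ G) :
    M.rk (ψ '' S) = M.rk S := by
  have : {n : ℕ | ∃ I ⊆ ψ '' S, M.M.Indep I ∧ I.ncard = n} =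
      {n : ℕ | ∃ I ⊆ S, M.M.Indep I ∧ I.ncard = n} := by
    ext n
    constructor
    · rintro ⟨I, hI, hind, rfl⟩
      obtain ⟨J, hJ, rfl⟩ := subset_image_iff.mp hI
      exact ⟨J, hJ, (hψ J (hJ.trans hS)).mpr hind,
        (InjOn.ncard_image (hinj.mono (hJ.trans hS))).symm⟩
    · rintro ⟨J, hJ, hind, rfl⟩
      exact ⟨ψ '' J, image_mono hJ, (hψ J (hJ.trans hS)).mp hind,
        (InjOn.ncard_image (hinj.mono (hJ.trans hS)))⟩
  unfold rk mrk
  rw [this]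

theorem rk_map (σ : Equiv.Perm ℕ) (X : Set (Sym2 ℕ)) :
    M.rk (Sym2.map σ '' X) = M.rk X :=
  rk_iso (Sym2.map.injective σ.injective).injOn
    (fun S _ => (indep_map_iff σ S).symm) (Subset.refl X)

theorem isCircuit_map (σ : Equiv.Perm ℕ) {C : Set (Sym2 ℕ)} (hC : M.M.IsCircuit C) :
    M.M.IsCircuit (Sym2.map σ '' C) := by
  have hinj : Function.Injective (Sym2.map σ) := Sym2.map.injective σ.injective
  rw [Matroid.isCircuit_iff_dep_forall_sdiff_singleton_indep]
  refine ⟨⟨fun h => hC.not_indep ((indep_map_iff σ C).mp h), ?_⟩, ?_⟩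
  · rw [M.ground_eq]
    rintro _ ⟨e, he, rfl⟩
    have := hC.subset_ground he
    rw [M.ground_eq] at this
    simp only [mem_ofPred_eq] at this ⊢
    rwa [Sym2.isDiag_map σ.injective]
  · rintro _ ⟨e, he, rfl⟩
    rw [← image_singleton, ← image_sdiff hinj, indep_map_iff]
    exact hC.sdiff_singleton_indep he

/-- Extending a finite partial injection to a permutation of `ℕ`. -/
theorem exists_perm (s : Finset ℕ) (f : ℕ → ℕ) (hf : InjOn f s) :
    ∃ σ : Equiv.Perm ℕ, ∀ x ∈ s, σ x = f x := by
  classical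
  let e1 : {x // x ∈ s} ≃ {x // x ∈ f '' (s : Set ℕ)} := Equiv.Set.imageOfInjOn f s hf
  have i1 : Infinite {x // ¬ x ∈ s} := by
    have := (s.finite_toSet).infinite_compl
    exact this.to_subtype
  have i2 : Infinite {x // ¬ x ∈ f '' (s : Set ℕ)} := by
    have := ((s.finite_toSet).image f).infinite_compl
    exact this.to_subtype
  obtain ⟨e2⟩ : Nonempty ({x // ¬ x ∈ s} ≃ {x // ¬ x ∈ f '' (s : Set ℕ)}) :=
    nonempty_equiv_of_countable
  refine ⟨Equiv.subtypeCongr e1 e2, fun x hx => ?_⟩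
  simp [Equiv.subtypeCongr, hx, e1, Equiv.sumCompl_symm_apply_of_pos, Equiv.Set.imageOfInjOn]

end GraphMatroidFamily

namespace GraphMatroidFamily
open Set

variable {M : GraphMatroidFamily}

/-- The star with centre `x` and leaves `D`. -/
def starE (x : ℕ) (D : Set ℕ) : Set (Sym2 ℕ) := (fun y => s(x, y)) '' D

theorem starE_finite (x : ℕ) {D : Set ℕ} (hD : D.Finite) : (starE x D).Finite := hD.image _

theorem mem_starE {x a : ℕ} {D : Set ℕ} (ha : a ∈ D) : s(x, a) ∈ starE x D := ⟨a, ha, rfl⟩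

theorem starE_inj (x : ℕ) : Function.Injective (fun y => s(x, y)) := by
  intro a b h
  simp only [Sym2.eq_iff, true_and] at h
  rcases h with h | ⟨h1, h2⟩
  · exact h
  · exact h2.trans h1

theorem starE_ncard (x : ℕ) (D : Finset ℕ) : (starE x (D : Set ℕ)).ncard = D.card := by
  unfold starE
  rw [ncard_image_of_injective _ (starE_inj x), ncard_coe_finset]

theorem eSupp_finite {E : Set (Sym2 ℕ)} (hE : E.Finite) : (eSupp E).Finite := by
  have : eSupp E = ⋃ e ∈ E, {v | v ∈ e} := by
    ext v; simp [eSupp]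
  rw [this]
  refine hE.biUnion (fun e _ => ?_)
  induction e with
  | _ a b =>
    refine (Set.toFinite {a, b}).subset ?_
    intro v hv
    simpa using hv

theorem eSupp_mono {E F : Set (Sym2 ℕ)} (h : E ⊆ F) : eSupp E ⊆ eSupp F := by
  rintro v ⟨e, he, hv⟩
  exact ⟨e, h he, hv⟩

theorem mk_mem_clique {a b : ℕ} {V : Set ℕ} : s(a, b) ∈ clique V ↔ a ≠ b ∧ a ∈ V ∧ b ∈ V := by
  simp [clique]

theorem clique_mono {V W : Set ℕ} (h : V ⊆ W) : clique V ⊆ clique W :=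
  fun _ he => ⟨he.1, fun v hv => h (he.2 v hv)⟩

theorem clique_finite {V : Set ℕ} (hV : V.Finite) : (clique V).Finite := by
  have : (Set.image2 (fun a b => s(a, b)) V V).Finite := hV.image2 _ hV
  refine this.subset ?_
  intro e he
  induction e with
  | _ a b =>
    rw [mk_mem_clique] at he
    exact ⟨a, he.2.1, b, he.2.2, rfl⟩

theorem subset_clique {E : Set (Sym2 ℕ)} (hE : IsGraph E) : E ⊆ clique (eSupp E) :=
  fun e he => ⟨hE.2 e he, fun _ hv => ⟨e, he, hv⟩⟩

theorem mem_ground {e : Sym2 ℕ} : e ∈ M.M.E ↔ ¬ e.IsDiag := by rw [M.ground_eq]; rfl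

/-- No circuit has a vertex of degree at most `d`. -/
def HLow (M : GraphMatroidFamily) (d : ℕ) : Prop :=
  ∀ C, M.M.IsCircuit C → ∀ (x : ℕ) (D : Finset ℕ), (∃ e ∈ C, x ∈ e) →
    (∀ e ∈ C, x ∈ e → ∃ y ∈ D, e = s(x, y)) → d < D.card

/-- Some circuit on at most `t` vertices has a vertex of degree `d + 1`. -/
def HUp (M : GraphMatroidFamily) (d t : ℕ) : Prop :=
  ∃ C, M.M.IsCircuit C ∧ ∃ S : Finset ℕ, C ⊆ clique S ∧ S.card = t ∧ ∃ v ∈ S, ∃ D : Finset ℕ,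
    D ⊆ S ∧ v ∉ D ∧ D.card = d + 1 ∧
    (∀ y ∈ D, s(v, y) ∈ C) ∧ ∀ e ∈ C, v ∈ e → ∃ y ∈ D, e = s(v, y)

theorem exists_dim (h : ∃ C, M.M.IsCircuit C) : ∃ d t, HLow M d ∧ HUp M d t := by
  classical
  let P : ℕ → Prop := fun m => ∃ C, M.M.IsCircuit C ∧ ∃ (v : ℕ) (D : Finset ℕ), D.card = m ∧
    (∃ e ∈ C, v ∈ e) ∧ ∀ e ∈ C, v ∈ e → ∃ y ∈ D, e = s(v, y)
  have := M.finitary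
  have hP : ∃ m, P m := by
    obtain ⟨C, hC⟩ := h
    obtain ⟨e, he⟩ := hC.nonempty
    induction e with
    | _ a b =>
      refine ⟨_, C, hC, a, (eSupp_finite hC.finite).toFinset, rfl, ⟨_, he, by simp⟩, ?_⟩
      intro f hf haf
      obtain ⟨y, rfl⟩ := Sym2.mem_iff_exists.mp haf
      refine ⟨y, ?_, rfl⟩
      simp only [Finite.mem_toFinset]
      exact ⟨_, hf, by simp⟩
  obtain ⟨C, hC, v, D, hcard, hne, hall⟩ := Nat.find_spec hP
  have hpos : 1 ≤ D.card := by
    obtain ⟨e, he, hve⟩ := hne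
    obtain ⟨y, hy, -⟩ := hall e he hve
    exact Finset.card_pos.mpr ⟨y, hy⟩
  have hDC : ∀ y ∈ D, s(v, y) ∈ C := by
    intro y hy
    by_contra hcon
    have hlt : (D.erase y).card < Nat.find hP := by
      rw [← hcard, Finset.card_erase_of_mem hy]; omega
    refine Nat.find_min hP hlt ⟨C, hC, v, D.erase y, rfl, hne, ?_⟩
    intro e he hve
    obtain ⟨z, hz, rfl⟩ := hall e he hve
    refine ⟨z, Finset.mem_erase.mpr ⟨?_, hz⟩, rfl⟩
    rintro rfl
    exact hcon he
  refine ⟨D.card - 1, (eSupp_finite hC.finite).toFinset.card, ?_, C, hC,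
    (eSupp_finite hC.finite).toFinset, ?_, rfl, v, ?_, D, ?_, ?_, by omega, hDC, hall⟩
  · intro C' hC' x D' hne' hall'
    have : Nat.find hP ≤ D'.card := Nat.find_min' hP ⟨C', hC', x, D', rfl, hne', hall'⟩
    omega
  · rw [Finite.coe_toFinset]
    exact subset_clique ⟨hC.finite, fun e he => mem_ground.mp (hC.subset_ground he)⟩
  · obtain ⟨e, he, hve⟩ := hne
    simp only [Finite.mem_toFinset]
    exact ⟨e, he, hve⟩
  · intro y hy
    simp only [Finite.mem_toFinset]
    exact ⟨_, hDC y hy, by simp⟩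
  · intro hv
    exact mem_ground.mp (hC.subset_ground (hDC v hv)) (by simp)

theorem HLow.notMem_closure {d : ℕ} (h : HLow M d) {E : Set (Sym2 ℕ)} {x y : ℕ} {D : Finset ℕ}
    (hx : x ∉ eSupp E) (hD : D.card < d) (hy : y ∉ D) :
    s(x, y) ∉ M.M.closure (E ∪ starE x D) := by
  classical
  intro hcon
  have hnot : s(x, y) ∉ E ∪ starE x D := by
    rintro (h1 | ⟨z, hz, h1⟩)
    · exact hx ⟨_, h1, by simp⟩
    · exact hy (by rw [← starE_inj x h1]; exact hz)
  obtain ⟨C, heC, hC, hCs⟩ := Matroid.exists_isCircuit_of_mem_closure hcon hnot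
  have := h C hC x (insert y D) ⟨_, hCs, by simp⟩ ?_
  · rw [Finset.card_insert_of_notMem hy] at this; omega
  · intro e he hxe
    rcases heC he with rfl | h1 | ⟨z, hz, rfl⟩
    · exact ⟨y, by simp, rfl⟩
    · exact absurd ⟨e, h1, hxe⟩ hx
    · exact ⟨z, by simp [show z ∈ D from hz], rfl⟩

theorem HUp.clique_subset {d t : ℕ} (h : HUp M d t) {W D : Finset ℕ} {x : ℕ} {Z : Set (Sym2 ℕ)}
    (hW : t ≤ W.card) (hx : x ∉ W) (hD : D ⊆ W) (hDc : d ≤ D.card)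
    (h1 : clique W ⊆ M.M.closure Z) (h2 : starE x D ⊆ M.M.closure Z) :
    clique (insert x W : Set ℕ) ⊆ M.M.closure Z := by
  classical
  obtain ⟨C, hC, S, hCS, hSc, v, hvS, D0, hD0S, hvD0, hD0c, hD0C, hall⟩ := h
  have key : ∀ y ∈ W, s(x, y) ∈ M.M.closure Z := by
    intro y hy
    by_cases hyD : y ∈ D
    · exact h2 (mem_starE hyD)
    obtain ⟨D', hD'D, hD'c⟩ := Finset.exists_subset_card_eq hDc
    have hyD' : y ∉ D' := fun h => hyD (hD'D h)
    have hins : (insert y D').card = d + 1 := by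
      rw [Finset.card_insert_of_notMem hyD', hD'c]
    have hinsW : insert y D' ⊆ W := Finset.insert_subset hy (hD'D.trans hD)
    have e1 : Nonempty (D0 ≃ (insert y D' : Finset ℕ)) :=
      ⟨Finset.equivOfCardEq (by rw [hD0c, hins])⟩
    obtain ⟨e1⟩ := e1
    have hR : ((S.erase v) \ D0).card ≤ (W \ insert y D').card := by
      have hsub : D0 ⊆ S.erase v :=
        fun z hz => Finset.mem_erase.mpr ⟨fun h => hvD0 (h ▸ hz), hD0S hz⟩
      rw [Finset.card_sdiff_of_subset hinsW, Finset.card_sdiff_of_subset hsub,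
        Finset.card_erase_of_mem hvS]
      omega
    obtain ⟨R', hR'W, hR'c⟩ := Finset.exists_subset_card_eq hR
    let e2 : ((S.erase v) \ D0 : Finset ℕ) ≃ R' := Finset.equivOfCardEq hR'c.symm
    let f : ℕ → ℕ := fun z => if z = v then x else if hz : z ∈ D0 then (e1 ⟨z, hz⟩ : ℕ)
      else if hz : z ∈ (S.erase v) \ D0 then (e2 ⟨z, hz⟩ : ℕ) else 0
    have fv : f v = x := by simp [f]
    have fD : ∀ z (hz : z ∈ D0), f z = e1 ⟨z, hz⟩ := by
      intro z hz
      have : z ≠ v := fun h => hvD0 (h ▸ hz)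
      simp [f, this, hz]
    have fR : ∀ z (hz : z ∈ (S.erase v) \ D0), f z = e2 ⟨z, hz⟩ := by
      intro z hz
      have hz' := hz
      simp only [Finset.mem_sdiff, Finset.mem_erase] at hz'
      simp only [f, hz'.1.1, hz'.2, if_false, dif_neg, not_false_eq_true, dif_pos hz]
    have fDW : ∀ z ∈ D0, f z ∈ insert y D' := by
      intro z hz; rw [fD z hz]; exact (e1 ⟨z, hz⟩).2
    have fRW : ∀ z ∈ (S.erase v) \ D0, f z ∈ W ∧ f z ∉ insert y D' := by
      intro z hz; rw [fR z hz]
      exact Finset.mem_sdiff.mp (hR'W (e2 ⟨z, hz⟩).2)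
    have tri : ∀ z ∈ S, z = v ∨ z ∈ D0 ∨ z ∈ (S.erase v) \ D0 := by
      intro z hz
      simp only [Finset.mem_sdiff, Finset.mem_erase]
      tauto
    have finj : InjOn f S := by
      intro a ha b hb hab
      rcases tri a ha with rfl | ha' | ha' <;> rcases tri b hb with rfl | hb' | hb'
      · rfl
      · exact absurd (hinsW (fDW b hb')) (by rw [← hab, fv]; exact hx)
      · exact absurd (fRW b hb').1 (by rw [← hab, fv]; exact hx)
      · exact absurd (hinsW (fDW a ha')) (by rw [hab, fv]; exact hx)
      · rw [fD a ha', fD b hb'] at hab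
        simpa using e1.injective (Subtype.ext hab)
      · exact absurd (fDW a ha') (by rw [hab]; exact (fRW b hb').2)
      · exact absurd (fRW a ha').1 (by rw [hab, fv]; exact hx)
      · exact absurd (fDW b hb') (by rw [← hab]; exact (fRW a ha').2)
      · rw [fR a ha', fR b hb'] at hab
        simpa using e2.injective (Subtype.ext hab)
    obtain ⟨σ, hσ⟩ := exists_perm S f finj
    have hC' := isCircuit_map σ hC
    have hmem : s(x, y) ∈ Sym2.map σ '' C := by
      have hz := (e1.symm ⟨y, by simp⟩).2
      refine ⟨s(v, (e1.symm ⟨y, by simp⟩ : ℕ)), hD0C _ hz, ?_⟩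
      rw [Sym2.map_mk, hσ v hvS, hσ _ (hD0S hz), fv, fD _ hz]
      simp
    have hcl := hC'.mem_closure_sdiff_singleton_of_mem hmem
    refine M.M.closure_subset_closure_of_subset_closure ?_ hcl
    rintro _ ⟨⟨e, he, rfl⟩, hne⟩
    by_cases hve : v ∈ e
    · obtain ⟨z, hz, rfl⟩ := hall e he hve
      rw [Sym2.map_mk, hσ v hvS, hσ _ (hD0S hz), fv] at hne ⊢
      have := fDW z hz
      rw [Finset.mem_insert] at this
      rcases this with h | h
      · rw [h] at hne; exact absurd rfl hne
      · exact h2 (mem_starE (hD'D h))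
    · apply h1
      have hek := hCS he
      induction e with
      | _ a b =>
        rw [mk_mem_clique] at hek
        simp only [Sym2.mem_iff, not_or] at hve
        have hfW : ∀ z ∈ S, v ≠ z → f z ∈ W := by
          intro z hz hvz
          rcases tri z hz with rfl | h | h
          · exact absurd rfl hvz
          · exact hinsW (fDW z h)
          · exact (fRW z h).1
        rw [Sym2.map_mk, hσ a hek.2.1, hσ b hek.2.2, mk_mem_clique]
        exact ⟨fun h => hek.1 (finj hek.2.1 hek.2.2 h), hfW a hek.2.1 hve.1, hfW b hek.2.2 hve.2⟩
  intro e he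
  induction e with
  | _ a b =>
    rw [mk_mem_clique] at he
    obtain ⟨hab, ha, hb⟩ := he
    rcases ha with rfl | ha <;> rcases hb with rfl | hb
    · exact absurd rfl hab
    · exact key b hb
    · rw [Sym2.eq_swap]; exact key a ha
    · exact h1 (mk_mem_clique.mpr ⟨hab, ha, hb⟩)

end GraphMatroidFamily

namespace GraphMatroidFamily
open Set

variable {M : GraphMatroidFamily}

theorem HUp.le {d t : ℕ} (h : HUp M d t) : d ≤ t := by
  obtain ⟨C, hC, S, hCS, hSc, v, hvS, D0, hD0S, hvD0, hD0c, -⟩ := h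
  have := Finset.card_le_card hD0S
  omega

theorem rk_add_star {d : ℕ} (h : HLow M d) {E : Set (Sym2 ℕ)} (hE : E.Finite) {x : ℕ}
    (hx : x ∉ eSupp E) (D : Finset ℕ) (hxD : x ∉ D) (hD : D.card ≤ d) :
    M.rk E + D.card ≤ M.rk (E ∪ starE x D) := by
  classical
  induction D using Finset.induction_on with
  | empty => simp [starE]
  | insert y D hy ih =>
    rw [Finset.card_insert_of_notMem hy] at hD ⊢
    have ih' := ih (fun h => hxD (Finset.mem_insert_of_mem h)) (by omega)
    have hcl := h.notMem_closure hx (show D.card < d by omega) hy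
    have hr := rk_insert (hE.union (starE_finite x D.finite_toSet))
      (show ¬ (s(x, y)).IsDiag by
        simp only [Sym2.mk_isDiag_iff]; rintro rfl; exact hxD (by simp)) hcl
    have heq : E ∪ starE x (insert y D : Finset ℕ) = insert s(x, y) (E ∪ starE x D) := by
      rw [Finset.coe_insert]
      unfold starE
      rw [image_insert_eq, union_insert]
    rw [heq, hr]
    omega

theorem deleteVerts_subset (E : Set (Sym2 ℕ)) (T : Set ℕ) : deleteVerts E T ⊆ E := fun _ h => h.1

theorem mk_mem_deleteVerts {E : Set (Sym2 ℕ)} {T : Set ℕ} {a b : ℕ} :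
    s(a, b) ∈ deleteVerts E T ↔ s(a, b) ∈ E ∧ a ∉ T ∧ b ∉ T := by
  simp [deleteVerts]

theorem rk_deleteVert {d : ℕ} (h : HLow M d) {E : Set (Sym2 ℕ)} (hE : IsGraph E) {x : ℕ}
    (D : Finset ℕ) (hDE : ∀ y ∈ D, s(x, y) ∈ E) (hD : D.card ≤ d) :
    M.rk (deleteVerts E {x}) + D.card ≤ M.rk E := by
  refine (rk_add_star h (hE.1.subset (deleteVerts_subset _ _)) (x := x) ?_ D ?_ hD).trans ?_
  · rintro ⟨e, he, hxe⟩
    exact he.2 x hxe rfl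
  · intro hx
    exact hE.2 _ (hDE x hx) (by simp)
  · refine rk_mono hE.1 (union_subset (deleteVerts_subset _ _) ?_)
    rintro _ ⟨y, hy, rfl⟩
    exact hDE y hy

theorem rk_star {d : ℕ} (h : HLow M d) (hd : 1 ≤ d) (x : ℕ) (D : Finset ℕ) (hxD : x ∉ D) :
    D.card ≤ M.rk (starE x D) := by
  classical
  induction D using Finset.induction_on with
  | empty => simp
  | insert y D hy ih =>
    have ih' := ih (fun h => hxD (Finset.mem_insert_of_mem h))
    have hyx : y ≠ x := by rintro rfl; exact hxD (by simp)
    have := rk_add_star h (starE_finite x D.finite_toSet) (x := y) ?_ {x} (by simpa using hyx)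
      (by simpa using hd)
    · rw [Finset.card_insert_of_notMem hy]
      have heq : starE x (insert y D : Finset ℕ) = starE x D ∪ starE y ({x} : Finset ℕ) := by
        rw [Finset.coe_insert]
        unfold starE
        rw [image_insert_eq, insert_eq, union_comm]
        simp [Sym2.eq_swap]
      rw [heq]
      simp only [Finset.card_singleton] at this
      omega
    · rintro ⟨_, ⟨z, hz, rfl⟩, hy'⟩
      simp only [Sym2.mem_iff] at hy'
      rcases hy' with h | h
      · exact hyx h
      · exact hy (h ▸ hz)

theorem rk_clique_insert_le {d t : ℕ} (h : HUp M d t) {W : Finset ℕ} {x : ℕ}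
    (hW : t ≤ W.card) (hx : x ∉ W) :
    M.rk (clique (insert x W : Set ℕ)) ≤ M.rk (clique (W : Set ℕ)) + d := by
  obtain ⟨D, hDW, hDc⟩ := Finset.exists_subset_card_eq (h.le.trans hW)
  have hfin : (clique (W : Set ℕ) ∪ starE x D).Finite :=
    (clique_finite W.finite_toSet).union (starE_finite x D.finite_toSet)
  have hgr : clique (W : Set ℕ) ∪ starE x D ⊆ M.M.E := by
    rintro e (he | ⟨y, hy, rfl⟩)
    · exact mem_ground.mpr he.1
    · rw [mem_ground]
      simp only [Sym2.mk_isDiag_iff]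
      rintro rfl
      exact hx (hDW hy)
  have hsub := M.M.subset_closure _ hgr
  have h1 := h.clique_subset hW hx hDW hDc.ge (subset_union_left.trans hsub)
    (subset_union_right.trans hsub)
  have h2 := rk_closure_le hfin (clique_finite (W.finite_toSet.insert x)) h1
  have h3 := rk_union_le (M := M) (clique_finite W.finite_toSet) (starE_finite x D.finite_toSet)
  have h4 := rk_le_ncard (M := M) (starE_finite x D.finite_toSet)
  rw [starE_ncard] at h4
  omega

theorem rk_clique_perm (σ : Equiv.Perm ℕ) (W : Set ℕ) :
    M.rk (clique (σ '' W)) = M.rk (clique W) := by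
  rw [← rk_map (M := M) σ (clique W)]
  congr 1
  ext e
  constructor
  · intro he
    refine ⟨Sym2.map σ.symm e, ?_, ?_⟩
    · induction e with
      | _ a b =>
        rw [mk_mem_clique] at he
        obtain ⟨hab, ⟨a, ha, rfl⟩, ⟨b, hb, rfl⟩⟩ := he
        simp only [Sym2.map_mk, Equiv.symm_apply_apply]
        exact mk_mem_clique.mpr ⟨fun h => hab (by rw [h]), ha, hb⟩
    · rw [Sym2.map_map]; simp
  · rintro ⟨f, hf, rfl⟩
    induction f with
    | _ a b =>
      rw [mk_mem_clique] at hf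
      rw [Sym2.map_mk, mk_mem_clique]
      exact ⟨fun h => hf.1 (σ.injective h), ⟨a, hf.2.1, rfl⟩, ⟨b, hf.2.2, rfl⟩⟩

theorem rk_clique_card (W : Finset ℕ) : M.rk (clique (W : Set ℕ)) = M.rk (cliqueN W.card) := by
  classical
  let e : (Finset.range W.card : Finset ℕ) ≃ W := Finset.equivOfCardEq (by simp)
  let f : ℕ → ℕ := fun z => if hz : z ∈ Finset.range W.card then (e ⟨z, hz⟩ : ℕ) else 0
  have hf : ∀ z (hz : z ∈ Finset.range W.card), f z = e ⟨z, hz⟩ := fun z hz => by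
    simp only [f, dif_pos hz]
  obtain ⟨σ, hσ⟩ := exists_perm (Finset.range W.card) f (by
    intro a ha b hb hab
    rw [hf a ha, hf b hb] at hab
    simpa using e.injective (Subtype.ext hab))
  have himg : σ '' {v | v < W.card} = (W : Set ℕ) := by
    ext y
    constructor
    · rintro ⟨z, hz, rfl⟩
      have hz' : z ∈ Finset.range W.card := Finset.mem_range.mpr hz
      rw [hσ z hz', hf z hz']
      exact (e ⟨z, hz'⟩).2
    · intro hy
      have hz' := (e.symm ⟨y, hy⟩).2
      refine ⟨e.symm ⟨y, hy⟩, Finset.mem_range.mp hz', ?_⟩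
      rw [hσ _ hz', hf _ hz']
      simp
  rw [← himg, rk_clique_perm]
  rfl

theorem cliqueN_finite (n : ℕ) : (cliqueN n).Finite := clique_finite (Set.finite_lt_nat n)

theorem R_mono {m n : ℕ} (h : m ≤ n) : M.rk (cliqueN m) ≤ M.rk (cliqueN n) :=
  rk_mono (cliqueN_finite n) (clique_mono fun _ hv => lt_of_lt_of_le hv h)

theorem cliqueN_succ (n : ℕ) :
    cliqueN (n + 1) = clique (insert n (Finset.range n : Finset ℕ) : Set ℕ) := by
  unfold cliqueN
  congr 1
  ext v
  simp

theorem R_succ_le {d t : ℕ} (h : HUp M d t) {n : ℕ} (hn : t ≤ n) :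
    M.rk (cliqueN (n + 1)) ≤ M.rk (cliqueN n) + d := by
  rw [cliqueN_succ]
  refine (rk_clique_insert_le h (by simpa using hn) (by simp)).trans ?_
  rw [rk_clique_card]
  simp

theorem R_succ_ge {d : ℕ} (h : HLow M d) {n : ℕ} (hn : d ≤ n) :
    M.rk (cliqueN n) + d ≤ M.rk (cliqueN (n + 1)) := by
  have hg : IsGraph (cliqueN (n + 1)) := ⟨cliqueN_finite _, fun e he => he.1⟩
  have := rk_deleteVert h hg (x := n) (Finset.range d) ?_ (by simp)
  · simp only [Finset.card_range] at this
    refine le_trans (Nat.add_le_add_right (rk_mono (hg.1.subset (deleteVerts_subset _ _)) ?_) d) this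
    rintro e ⟨he, hev⟩
    refine ⟨⟨he, fun v hv => Nat.lt_succ_of_lt (hev v hv)⟩, ?_⟩
    rintro v hv rfl
    have hlt : v < v := hev v hv
    exact lt_irrefl _ hlt
  · intro y hy
    rw [Finset.mem_range] at hy
    refine mk_mem_clique.mpr ⟨by omega, ?_, ?_⟩
    · exact Nat.lt_succ_self n
    · exact Nat.lt_succ_of_lt (by omega)

theorem HUp.pos {d t : ℕ} (h : HUp M d t) (hM : M.Unbounded) : 1 ≤ d := by
  by_contra hd
  obtain rfl : d = 0 := by omega
  have hb : ∀ n, M.rk (cliqueN (t + n)) ≤ M.rk (cliqueN t) := by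
    intro n
    induction n with
    | zero => exact le_rfl
    | succ n ih =>
      have := R_succ_le h (show t ≤ t + n by omega)
      rw [← add_assoc]; omega
  obtain ⟨n, hn⟩ := hM (M.rk (cliqueN t))
  have h1 := hb n
  have h2 := R_mono (M := M) (show n ≤ t + n by omega)
  omega

/-- The dimension data of a nontrivial unbounded family. -/
structure Dim (M : GraphMatroidFamily) (d t : ℕ) : Prop where
  low : HLow M d
  up : HUp M d t
  pos : 1 ≤ d

theorem Dim.le {d t : ℕ} (h : Dim M d t) : d ≤ t := h.up.le

theorem Dim.R_add {d t : ℕ} (h : Dim M d t) {n : ℕ} (hn : t ≤ n) (m : ℕ) :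
    M.rk (cliqueN (n + m)) = M.rk (cliqueN n) + d * m := by
  induction m with
  | zero => simp
  | succ m ih =>
    have h1 := R_succ_le h.up (show t ≤ n + m by omega)
    have h2 := R_succ_ge h.low (show d ≤ n + m by have := h.le; omega)
    rw [← add_assoc, mul_add]
    omega

theorem Dim.card_eq {d t : ℕ} (h : Dim M d t) {m n : ℕ} (hn : t < n)
    (hmn : M.rk (cliqueN m) = M.rk (cliqueN n)) : m = n := by
  have hp := h.pos
  rcases lt_trichotomy m n with hlt | heq | hgt
  · have h1 := h.R_add (n := n - 1) (by omega) 1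
    rw [show n - 1 + 1 = n by omega] at h1
    have h2 := R_mono (M := M) (show m ≤ n - 1 by omega)
    omega
  · exact heq
  · have h1 := h.R_add (n := n) (by omega) 1
    have h2 := R_mono (M := M) (show n + 1 ≤ m by omega)
    omega

theorem exists_Dim (hM : M.Unbounded) (h : ∃ C, M.M.IsCircuit C) : ∃ d t, Dim M d t := by
  obtain ⟨d, t, h1, h2⟩ := exists_dim h
  exact ⟨d, t, h1, h2, h2.pos hM⟩

theorem pendant_notMem_closure (hM : M.Unbounded) {E : Set (Sym2 ℕ)} {x y : ℕ}
    (hx : x ∉ eSupp E) : s(x, y) ∉ M.M.closure E := by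
  intro hcon
  have hnot : s(x, y) ∉ E := fun h => hx ⟨_, h, by simp⟩
  obtain ⟨C, -, hC, -⟩ := Matroid.exists_isCircuit_of_mem_closure hcon hnot
  obtain ⟨d, t, hd⟩ := exists_Dim hM ⟨C, hC⟩
  refine hd.low.notMem_closure (D := ∅) (y := y) hx hd.pos (by simp) ?_
  simpa [starE] using hcon

end GraphMatroidFamily

namespace GraphMatroidFamily
open Set

variable {M : GraphMatroidFamily}

/-- A cut-based reformulation of `c`-connectivity. -/
def KC (c : ℕ) (E : Set (Sym2 ℕ)) : Prop :=
  c < (eSupp E).ncard ∧ ∀ S : Finset ℕ, S.card < c → ∀ P : Set ℕ,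
    (∃ x ∈ eSupp E, x ∉ S ∧ x ∈ P) →
    (∀ u w, s(u, w) ∈ E → u ∉ S → w ∉ S → u ∈ P → w ∈ P) →
    ∀ y ∈ eSupp E, y ∉ S → y ∈ P

theorem kc_iff {E : Set (Sym2 ℕ)} (hE : IsGraph E) (c : ℕ) : KConnected c E ↔ KC c E := by
  refine and_congr_right fun hc => forall_congr' fun S => forall_congr' fun hS => ?_
  constructor
  · rintro hcon P ⟨x, hxE, hxS, hxP⟩ hP y hyE hyS
    have hr := hcon.preconnected ⟨x, hxE, hxS⟩ ⟨y, hyE, hyS⟩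
    rw [SimpleGraph.reachable_iff_reflTransGen] at hr
    have : ∀ z, Relation.ReflTransGen
        ((SimpleGraph.fromEdgeSet E).induce (eSupp E \ ↑S)).Adj ⟨x, hxE, hxS⟩ z → (z : ℕ) ∈ P := by
      intro z hz
      induction hz with
      | refl => exact hxP
      | @tail b z' _ hadj ih =>
        have h1 : s((b : ℕ), (z' : ℕ)) ∈ E := by
          simp only [SimpleGraph.comap_adj, SimpleGraph.fromEdgeSet_adj] at hadj
          exact hadj.1
        exact hP _ _ h1 b.2.2 z'.2.2 ih
    exact this _ hr
  · intro h
    have hfin := eSupp_finite hE.1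
    have hne : (eSupp E \ ↑S).Nonempty := by
      by_contra hcon
      rw [not_nonempty_iff_eq_empty, sdiff_eq_empty] at hcon
      have := ncard_le_ncard hcon S.finite_toSet
      rw [ncard_coe_finset] at this
      omega
    rw [SimpleGraph.connected_iff]
    refine ⟨?_, hne.to_subtype⟩
    intro x y
    let G' := (SimpleGraph.fromEdgeSet E).induce (eSupp E \ ↑S)
    have := h {v | ∃ hv : v ∈ eSupp E \ ↑S, G'.Reachable x ⟨v, hv⟩}
      ⟨x, x.2.1, x.2.2, x.2, SimpleGraph.Reachable.refl _⟩ ?_ y y.2.1 y.2.2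
    · obtain ⟨_, hr⟩ := this
      exact hr
    · rintro u w huw huS hwS ⟨hu, hr⟩
      refine ⟨⟨⟨_, huw, by simp⟩, hwS⟩, hr.trans (SimpleGraph.Adj.reachable ?_)⟩
      simp only [G', SimpleGraph.comap_adj, SimpleGraph.fromEdgeSet_adj]
      refine ⟨huw, ?_⟩
      have := hE.2 _ huw
      simpa using this

theorem exists_nbr {E : Set (Sym2 ℕ)} {v : ℕ} (hv : v ∈ eSupp E) : ∃ w, s(v, w) ∈ E := by
  obtain ⟨e, he, hve⟩ := hv
  obtain ⟨w, rfl⟩ := Sym2.mem_iff_exists.mp hve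
  exact ⟨w, he⟩

theorem nb_finite {E : Set (Sym2 ℕ)} (hE : E.Finite) (v : ℕ) : {w | s(v, w) ∈ E}.Finite :=
  (eSupp_finite hE).subset fun w hw => ⟨_, hw, by simp⟩

theorem KC.deg {c : ℕ} {E : Set (Sym2 ℕ)} (h : KC c E) {v : ℕ} (hv : v ∈ eSupp E) (N : Finset ℕ)
    (hN : ∀ w, s(v, w) ∈ E → w ∈ N) : c ≤ N.card := by
  classical
  by_contra hcon
  have hle : (N.erase v).card ≤ N.card := Finset.card_le_card (Finset.erase_subset _ _)
  have := h.2 (N.erase v) (by omega) {v} ⟨v, hv, by simp, rfl⟩ ?_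
  · have hsub : eSupp E ⊆ (insert v (N.erase v) : Finset ℕ) := by
      intro y hy
      by_cases hyS : y ∈ N.erase v
      · simp only [Finset.coe_insert]; exact Or.inr hyS
      · have := this y hy hyS
        rw [mem_singleton_iff] at this
        simp [this]
    have h1 := ncard_le_ncard hsub (Finset.finite_toSet _)
    rw [ncard_coe_finset] at h1
    have h2 := Finset.card_insert_le v (N.erase v)
    have := h.1
    omega
  · rintro u w huw huS hwS hu
    rw [mem_singleton_iff] at hu ⊢
    subst hu
    by_contra hne
    exact hwS (Finset.mem_erase.mpr ⟨hne, hN w huw⟩)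

theorem isGraph_deleteVerts {E : Set (Sym2 ℕ)} (hE : IsGraph E) (T : Set ℕ) :
    IsGraph (deleteVerts E T) :=
  ⟨hE.1.subset (deleteVerts_subset _ _), fun e he => hE.2 e he.1⟩

theorem KC.eSupp_delete {c : ℕ} {E : Set (Sym2 ℕ)} (h : KC c E) (T : Finset ℕ) (hT : T.card < c) :
    eSupp (deleteVerts E T) = eSupp E \ T := by
  classical
  ext v
  constructor
  · rintro ⟨e, he, hve⟩
    exact ⟨⟨e, he.1, hve⟩, he.2 v hve⟩
  · rintro ⟨hv, hvT⟩
    by_contra hcon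
    have := h.2 T hT {v} ⟨v, hv, hvT, rfl⟩ ?_
    · have hsub : eSupp E ⊆ (insert v T : Finset ℕ) := by
        intro y hy
        by_cases hyS : y ∈ T
        · simp only [Finset.coe_insert]; exact Or.inr hyS
        · have := this y hy hyS
          rw [mem_singleton_iff] at this
          simp [this]
      have h1 := ncard_le_ncard hsub (Finset.finite_toSet _)
      rw [ncard_coe_finset] at h1
      have h2 := Finset.card_insert_le v T
      have := h.1
      omega
    · rintro u w huw huS hwS hu
      rw [mem_singleton_iff] at hu
      subst hu
      exact absurd ⟨_, mk_mem_deleteVerts.mpr ⟨huw, huS, hwS⟩, by simp⟩ hcon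

theorem KC.delete {c c' : ℕ} {E : Set (Sym2 ℕ)} (h : KC c E) (hE : E.Finite) (T : Finset ℕ)
    (hT : T.card < c) (hc : T.card + c' ≤ c) : KC c' (deleteVerts E T) := by
  classical
  have hs := h.eSupp_delete T hT
  refine ⟨?_, ?_⟩
  · rw [hs]
    have h1 := h.1
    have h2 := le_ncard_sdiff (T : Set ℕ) (eSupp E) T.finite_toSet
    rw [ncard_coe_finset] at h2
    omega
  · rintro S hS P ⟨x, hx, hxS, hxP⟩ hP y hy hyS
    rw [hs] at hx hy
    have hcard := Finset.card_union_le T S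
    refine h.2 (T ∪ S) (by omega) P ⟨x, hx.1, ?_, hxP⟩ ?_ y hy.1 ?_
    · rw [Finset.mem_union]; rintro (h | h)
      exacts [hx.2 h, hxS h]
    · intro u w huw hu hw huP
      rw [Finset.mem_union, not_or] at hu hw
      exact hP u w (mk_mem_deleteVerts.mpr ⟨huw, hu.1, hw.1⟩) hu.2 hw.2 huP
    · rw [Finset.mem_union]; rintro (h | h)
      exacts [hy.2 h, hyS h]

theorem KC.mono {c c' : ℕ} {E : Set (Sym2 ℕ)} (h : KC c E) (hc : c' ≤ c) : KC c' E :=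
  ⟨hc.trans_lt h.1, fun S hS => h.2 S (hS.trans_le hc)⟩

theorem rk_clique_ncard {V : Set ℕ} (hV : V.Finite) :
    M.rk (clique V) = M.rk (cliqueN V.ncard) := by
  have := rk_clique_card (M := M) hV.toFinset
  rw [Finite.coe_toFinset] at this
  rw [this, ncard_eq_toFinset_card V hV]

theorem rk_of_rigid {E : Set (Sym2 ℕ)} (hE : IsGraph E) (h : M.Rigid E) :
    M.rk E = M.rk (cliqueN (eSupp E).ncard) := by
  rw [← rk_clique_ncard (eSupp_finite hE.1)]
  exact h

/-- A form of vertical `k`-connectivity of `M(E)`. -/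
def VC (M : GraphMatroidFamily) (k : ℕ) (E : Set (Sym2 ℕ)) : Prop :=
  ∀ A B, A ∪ B = E → M.rk A + M.rk B < M.rk E + k → M.rk A = M.rk E ∨ M.rk B = M.rk E

/-- Lovász–Yemini with explicit constant. -/
def LY (M : GraphMatroidFamily) (c : ℕ) : Prop :=
  ∀ E : Set (Sym2 ℕ), IsGraph E → KC c E → M.Rigid E

theorem LY.rk_delete {c c' : ℕ} (h : LY M c) {E : Set (Sym2 ℕ)} (hE : IsGraph E) (hc : KC c' E)
    (T : Finset ℕ) (hTE : ↑T ⊆ eSupp E) (hT : T.card < c') (hT' : T.card + c ≤ c') :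
    M.rk (deleteVerts E T) = M.rk (cliqueN ((eSupp E).ncard - T.card)) := by
  rw [rk_of_rigid (isGraph_deleteVerts hE T) (h _ (isGraph_deleteVerts hE T)
    (hc.delete hE.1 T hT hT')), hc.eSupp_delete T hT, ncard_sdiff hTE T.finite_toSet,
    ncard_coe_finset]

theorem vc_final {c c' d t k : ℕ} (hd : Dim M d t) (hLY : LY M c)
    (hc' : c + t + d * k + 2 * k + 2 * d + 5 ≤ c')
    {G A B : Set (Sym2 ℕ)} (hG : IsGraph G) (hKC : KC c' G) (hAB : A ∪ B = G)
    (T : Finset ℕ) (hTG : ↑T ⊆ eSupp G) (hTk : T.card < k) (hBT : deleteVerts B T = ∅) :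
    M.rk A = M.rk G ∨ M.rk G + k ≤ M.rk A + M.rk B := by
  classical
  have hA : IsGraph A := ⟨hG.1.subset (hAB ▸ subset_union_left),
    fun e he => hG.2 e (hAB ▸ Or.inl he)⟩
  have hB : IsGraph B := ⟨hG.1.subset (hAB ▸ subset_union_right),
    fun e he => hG.2 e (hAB ▸ Or.inr he)⟩
  have hAgr : A ⊆ M.M.closure A :=
    M.M.subset_closure A fun e he => mem_ground.mpr (hA.2 e he)
  have hVfin := eSupp_finite hG.1
  have hGT : deleteVerts G T ⊆ A := by
    intro e he
    have := he.1
    rw [← hAB] at this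
    rcases this with h | h
    · exact h
    · exact absurd (show e ∈ deleteVerts B T from ⟨h, he.2⟩) (by rw [hBT]; simp)
  have hr := hLY.rk_delete hG hKC T hTG (by omega) (by omega)
  have hn := hKC.1
  let W0 : Finset ℕ := hVfin.toFinset \ T
  have hW0 : (W0 : Set ℕ) = eSupp G \ T := by simp [W0]
  have hW0c : W0.card = (eSupp G).ncard - T.card := by
    rw [← ncard_coe_finset, hW0, ncard_sdiff hTG T.finite_toSet, ncard_coe_finset]
  have hcl0 : clique (W0 : Set ℕ) ⊆ M.M.closure A := by
    refine Subset.trans ?_ (M.M.closure_subset_closure hGT)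
    refine subset_closure_of_rk (clique_finite W0.finite_toSet) (fun e he => he.1) ?_ ?_
    · have := subset_clique (isGraph_deleteVerts hG T)
      rwa [hKC.eSupp_delete T (by omega), ← hW0] at this
    · rw [rk_clique_card, hW0c, hr]
  let NA : ℕ → Finset ℕ := fun v => (nb_finite hA.1 v).toFinset
  have hNA : ∀ v w, w ∈ NA v ↔ s(v, w) ∈ A := fun v w => by simp [NA]
  by_cases hall : ∀ v ∈ T, d ≤ (NA v \ T).card
  · left
    have hind : ∀ T0 : Finset ℕ, T0 ⊆ T → clique (↑(W0 ∪ T0) : Set ℕ) ⊆ M.M.closure A := by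
      intro T0
      induction T0 using Finset.induction_on with
      | empty => intro _; simpa using hcl0
      | insert v T0 hv ih =>
        intro hT0
        have hvT : v ∈ T := hT0 (by simp)
        have ih' := ih fun z hz => hT0 (Finset.mem_insert_of_mem hz)
        have := hd.up.clique_subset (W := W0 ∪ T0) (x := v) (D := NA v \ T) (Z := A) ?_ ?_ ?_
          (hall v hvT) ih' ?_
        · convert this using 2
          push_cast
          rw [union_insert]
        · have := Finset.card_le_card (Finset.subset_union_left (s₁ := W0) (s₂ := T0))
          omega
        · simp only [Finset.mem_union, not_or]
          exact ⟨fun h => (Finset.mem_sdiff.mp h).2 hvT, hv⟩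
        · intro w hw
          rw [Finset.mem_sdiff, hNA] at hw
          refine Finset.mem_union_left _ (Finset.mem_sdiff.mpr ⟨?_, hw.2⟩)
          rw [Finite.mem_toFinset]
          exact ⟨s(v, w), hAB ▸ Or.inl hw.1, by simp⟩
        · rintro _ ⟨w, hw, rfl⟩
          have hw' : w ∈ NA v \ T := hw
          rw [Finset.mem_sdiff, hNA] at hw'
          exact hAgr hw'.1
    have hfull := hind T Subset.rfl
    have hGA : G ⊆ M.M.closure A := by
      refine (subset_clique hG).trans ((clique_mono ?_).trans hfull)
      intro v hv
      by_cases hvT : v ∈ T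
      · simp [hvT]
      · simp [W0, hvT, hv]
    exact le_antisymm (rk_mono hG.1 (hAB ▸ subset_union_left)) (rk_closure_le hA.1 hG.1 hGA)
  · right
    push Not at hall
    obtain ⟨v, hvT, hvd⟩ := hall
    let NB : Finset ℕ := (nb_finite hB.1 v).toFinset
    have hNB : ∀ w, w ∈ NB ↔ s(v, w) ∈ B := fun w => by simp [NB]
    have hdeg := hKC.deg (hTG hvT) ((NA v \ T) ∪ T ∪ NB) (by
      intro w hw
      rw [← hAB] at hw
      simp only [Finset.mem_union, Finset.mem_sdiff, hNA, hNB]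
      rcases hw with h | h <;> tauto)
    have hu1 := Finset.card_union_le (NA v \ T ∪ T) NB
    have hu2 := Finset.card_union_le (NA v \ T) T
    have hrB : NB.card ≤ M.rk B := by
      refine (rk_star hd.low hd.pos v NB ?_).trans (rk_mono hB.1 ?_)
      · rw [hNB]; intro h; exact hB.2 _ h (by simp)
      · rintro _ ⟨w, hw, rfl⟩
        exact (hNB w).mp hw
    have hrA := rk_mono (M := M) hA.1 hGT
    have hrG : M.rk G ≤ M.rk (cliqueN (eSupp G).ncard) := by
      rw [← rk_clique_ncard hVfin]
      exact rk_mono (clique_finite hVfin) (subset_clique hG)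
    have hRa := hd.R_add (n := (eSupp G).ncard - T.card) (by omega) T.card
    rw [show (eSupp G).ncard - T.card + T.card = (eSupp G).ncard by omega] at hRa
    have hmul : d * T.card ≤ d * k := Nat.mul_le_mul_left d hTk.le
    omega

theorem deleteVerts_insert (E : Set (Sym2 ℕ)) (T : Set ℕ) (v : ℕ) :
    deleteVerts (deleteVerts E T) {v} = deleteVerts E (insert v T) := by
  ext e
  simp only [deleteVerts, mem_ofPred_eq, mem_singleton_iff, mem_insert_iff, not_or]
  constructor
  · rintro ⟨⟨h1, h2⟩, h3⟩
    exact ⟨h1, fun w hw => ⟨h3 w hw, h2 w hw⟩⟩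
  · rintro ⟨h1, h2⟩
    exact ⟨⟨h1, fun w hw => (h2 w hw).2⟩, fun w hw => (h2 w hw).1⟩

theorem deleteVerts_union (A B : Set (Sym2 ℕ)) (T : Set ℕ) :
    deleteVerts (A ∪ B) T = deleteVerts A T ∪ deleteVerts B T := by
  ext e
  simp only [deleteVerts, mem_ofPred_eq, mem_union]
  tauto

theorem vc_of_kc {c c' d t k : ℕ} (hd : Dim M d t) (hLY : LY M c)
    (hc' : c + t + d * k + 2 * k + 2 * d + 5 ≤ c')
    {G : Set (Sym2 ℕ)} (hG : IsGraph G) (hKC : KC c' G) : VC M k G := by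
  classical
  intro A B hAB hlt
  have hA : IsGraph A := ⟨hG.1.subset (hAB ▸ subset_union_left),
    fun e he => hG.2 e (hAB ▸ Or.inl he)⟩
  have hB : IsGraph B := ⟨hG.1.subset (hAB ▸ subset_union_right),
    fun e he => hG.2 e (hAB ▸ Or.inr he)⟩
  have hn := hKC.1
  have claim : ∀ j ≤ k, (∃ T : Finset ℕ, ↑T ⊆ eSupp G ∧ T.card = j ∧
      M.rk G + M.rk (deleteVerts A T) + M.rk (deleteVerts B T) + j ≤
        M.rk A + M.rk B + M.rk (deleteVerts G T)) ∨
      (∃ T : Finset ℕ, ↑T ⊆ eSupp G ∧ T.card < k ∧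
        (deleteVerts A T = ∅ ∨ deleteVerts B T = ∅)) := by
    intro j
    induction j with
    | zero =>
      intro _
      left
      refine ⟨∅, by simp, rfl, ?_⟩
      have : ∀ E : Set (Sym2 ℕ), deleteVerts E (↑(∅ : Finset ℕ)) = E := by
        intro E; ext e; simp [deleteVerts]
      rw [this, this, this]
      omega
    | succ j ih =>
      intro hj
      rcases ih (by omega) with ⟨T, hTG, hTj, hT⟩ | h
      swap
      · exact Or.inr h
      by_cases hv : ∃ v, v ∈ eSupp (deleteVerts A T) ∧ v ∈ eSupp (deleteVerts B T)
      · left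
        obtain ⟨v, hvA, hvB⟩ := hv
        have hAT := isGraph_deleteVerts hA T
        have hBT := isGraph_deleteVerts hB T
        have hvG : v ∈ eSupp (deleteVerts G T) := by
          rw [← hAB, deleteVerts_union]
          exact eSupp_mono subset_union_left hvA
        have hvGT := hvG
        rw [hKC.eSupp_delete T (by omega)] at hvGT
        have hvT : v ∉ T := hvGT.2
        have hTv : (insert v T).card = j + 1 := by rw [Finset.card_insert_of_notMem hvT, hTj]
        have hTvG : ((insert v T : Finset ℕ) : Set ℕ) ⊆ eSupp G := by
          rw [Finset.coe_insert]; exact insert_subset hvGT.1 hTG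
        refine ⟨insert v T, hTvG, hTv, ?_⟩
        let NA : Finset ℕ := (nb_finite hAT.1 v).toFinset
        let NB : Finset ℕ := (nb_finite hBT.1 v).toFinset
        have hNA : ∀ w, w ∈ NA ↔ s(v, w) ∈ deleteVerts A T := fun w => by simp [NA]
        have hNB : ∀ w, w ∈ NB ↔ s(v, w) ∈ deleteVerts B T := fun w => by simp [NB]
        have hdeg := (hKC.delete (c' := c' - j) hG.1 T (by omega) (by omega)).deg hvG (NA ∪ NB) (by
          intro w hw
          rw [← hAB, deleteVerts_union] at hw
          rw [Finset.mem_union, hNA, hNB]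
          exact hw)
        have hu := Finset.card_union_le NA NB
        have hNA1 : 1 ≤ NA.card := by
          obtain ⟨w, hw⟩ := exists_nbr hvA
          exact Finset.card_pos.mpr ⟨w, (hNA w).mpr hw⟩
        have hNB1 : 1 ≤ NB.card := by
          obtain ⟨w, hw⟩ := exists_nbr hvB
          exact Finset.card_pos.mpr ⟨w, (hNB w).mpr hw⟩
        obtain ⟨DA, hDA, hDAc⟩ := Finset.exists_subset_card_eq (min_le_right d NA.card)
        obtain ⟨DB, hDB, hDBc⟩ := Finset.exists_subset_card_eq (min_le_right d NB.card)
        have h1 := rk_deleteVert hd.low hAT (x := v) DA (fun y hy => (hNA y).mp (hDA hy)) (by omega)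
        have h2 := rk_deleteVert hd.low hBT (x := v) DB (fun y hy => (hNB y).mp (hDB hy)) (by omega)
        rw [deleteVerts_insert] at h1 h2
        have h3 := hLY.rk_delete hG hKC T hTG (by omega) (by omega)
        have h4 := hLY.rk_delete hG hKC (insert v T) hTvG (by omega) (by omega)
        have h5 := hd.R_add (n := (eSupp G).ncard - (insert v T).card) (by omega) 1
        rw [show (eSupp G).ncard - (insert v T).card + 1 = (eSupp G).ncard - T.card by omega] at h5
        rw [← h3, ← h4] at h5
        rw [Finset.coe_insert] at h5 ⊢
        have hp := hd.pos
        omega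
      · right
        refine ⟨T, hTG, by omega, ?_⟩
        by_contra hcon
        push Not at hcon
        obtain ⟨⟨e, he⟩, ⟨f, hf⟩⟩ := hcon
        push Not at hv
        induction e with
        | _ a a' =>
        induction f with
        | _ b b' =>
        have haA : a ∈ eSupp (deleteVerts A T) := ⟨_, he, by simp⟩
        have hbB : b ∈ eSupp (deleteVerts B T) := ⟨_, hf, by simp⟩
        rw [mk_mem_deleteVerts] at he hf
        refine hv b ?_ hbB
        refine hKC.2 T (by omega) (eSupp (deleteVerts A T)) ⟨a, ?_, he.2.1, haA⟩ ?_ b ?_ hf.2.1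
        · exact ⟨s(a, a'), hAB ▸ Or.inl he.1, by simp⟩
        · intro u w huw hu hw huA
          rw [← hAB] at huw
          rcases huw with h | h
          · exact ⟨_, mk_mem_deleteVerts.mpr ⟨h, hu, hw⟩, by simp⟩
          · exact absurd ⟨_, mk_mem_deleteVerts.mpr ⟨h, hu, hw⟩, by simp⟩ (hv u huA)
        · exact ⟨s(b, b'), hAB ▸ Or.inr hf.1, by simp⟩
  rcases claim k le_rfl with ⟨T, hTG, hTj, hT⟩ | ⟨T, hTG, hTk, h | h⟩
  · have h1 := rk_union_le (M := M) (isGraph_deleteVerts hA T).1 (isGraph_deleteVerts hB T).1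
    rw [← deleteVerts_union, hAB] at h1
    omega
  · rcases vc_final hd hLY hc' hG hKC (by rw [union_comm]; exact hAB) T hTG hTk h with h | h
    · exact Or.inr h
    · omega
  · rcases vc_final hd hLY hc' hG hKC hAB T hTG hTk h with h | h
    · exact Or.inl h
    · omega

end GraphMatroidFamily

namespace GraphMatroidFamily
open Set

variable {M : GraphMatroidFamily}

theorem rk_two_cliques {d t : ℕ} (hd : Dim M d t) {X Y S : Finset ℕ} (hS : d ≤ S.card)
    (hXY : Disjoint X Y) (hYS : Disjoint Y S) :
    M.rk (clique (↑(X ∪ S) : Set ℕ)) + d * Y.card ≤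
      M.rk (clique (↑(X ∪ S) : Set ℕ) ∪ clique (↑(Y ∪ S) : Set ℕ)) := by
  classical
  obtain ⟨D, hDS, hDc⟩ := Finset.exists_subset_card_eq hS
  have main : ∀ Y0 : Finset ℕ, Y0 ⊆ Y → M.rk (clique (↑(X ∪ S) : Set ℕ)) + d * Y0.card ≤
      M.rk (clique (↑(X ∪ S) : Set ℕ) ∪ clique (↑(Y0 ∪ S) : Set ℕ)) := by
    intro Y0
    induction Y0 using Finset.induction_on with
    | empty =>
      intro _
      simpa using rk_mono (M := M) ((clique_finite (Finset.finite_toSet (X ∪ S))).union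
        (clique_finite (Finset.finite_toSet (∅ ∪ S)))) subset_union_left
    | insert y Y0 hy ih =>
      intro hsub
      have hyY : y ∈ Y := hsub (by simp)
      have ih' := ih fun z hz => hsub (Finset.mem_insert_of_mem hz)
      have hyS : y ∉ S := fun h => Finset.disjoint_left.mp hYS hyY h
      have hyX : y ∉ X := fun h => Finset.disjoint_left.mp hXY h hyY
      let E : Set (Sym2 ℕ) := clique (↑(X ∪ S) : Set ℕ) ∪ clique (↑(insert y Y0 ∪ S) : Set ℕ)
      have hE : IsGraph E := ⟨(clique_finite (Finset.finite_toSet _)).union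
        (clique_finite (Finset.finite_toSet _)), by rintro e (he | he) <;> exact he.1⟩
      have h1 := rk_deleteVert hd.low hE (x := y) D (by
        intro z hz
        right
        rw [mk_mem_clique]
        refine ⟨?_, by simp, ?_⟩
        · rintro rfl; exact hyS (hDS hz)
        · have := hDS hz
          simp [this]) hDc.le
      have h2 : M.rk (clique (↑(X ∪ S) : Set ℕ) ∪ clique (↑(Y0 ∪ S) : Set ℕ)) ≤
          M.rk (deleteVerts E {y}) := by
        refine rk_mono (hE.1.subset (deleteVerts_subset _ _)) ?_
        rintro e (he | he)
        · refine ⟨Or.inl he, ?_⟩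
          rintro v hv rfl
          have := he.2 _ hv
          simp [hyS, hyX] at this
        · refine ⟨Or.inr (clique_mono ?_ he), ?_⟩
          · intro z hz
            simp only [Finset.coe_union, Finset.coe_insert, mem_union, mem_insert_iff] at hz ⊢
            tauto
          · rintro v hv rfl
            have := he.2 _ hv
            simp [hyS, hy] at this
      rw [Finset.card_insert_of_notMem hy, mul_add, mul_one]
      have h3 : M.rk E = M.rk (clique (↑(X ∪ S) : Set ℕ) ∪ clique (↑(insert y Y0 ∪ S) : Set ℕ)) := rfl
      omega
  exact main Y Subset.rfl

theorem kc_of_vc {c d t k : ℕ} (hd : Dim M d t) {H : Set (Sym2 ℕ)} (hH : IsGraph H)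
    (hVC : VC M k H) (hk : M.rk (cliqueN (t + c)) < k)
    (hr : M.rk (cliqueN (t + c)) < M.rk H) : KC c H := by
  classical
  have hVfin := eSupp_finite hH.1
  refine ⟨?_, ?_⟩
  · by_contra hcon
    have h1 : M.rk H ≤ M.rk (cliqueN (eSupp H).ncard) := by
      rw [← rk_clique_ncard hVfin]
      exact rk_mono (clique_finite hVfin) (subset_clique hH)
    have h2 := R_mono (M := M) (show (eSupp H).ncard ≤ t + c by omega)
    omega
  · rintro S hS P ⟨x, hxV, hxS, hxP⟩ hP y hyV hyS
    by_contra hyP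
    let X : Finset ℕ := hVfin.toFinset.filter (fun v => v ∈ P ∧ v ∉ S)
    let Y : Finset ℕ := hVfin.toFinset.filter (fun v => v ∉ P ∧ v ∉ S)
    have hX : ∀ v, v ∈ X ↔ v ∈ eSupp H ∧ v ∈ P ∧ v ∉ S := fun v => by simp [X]
    have hY : ∀ v, v ∈ Y ↔ v ∈ eSupp H ∧ v ∉ P ∧ v ∉ S := fun v => by simp [Y]
    have hinf : ((↑(hVfin.toFinset ∪ S) : Set ℕ)ᶜ).Infinite :=
      (Finset.finite_toSet _).infinite_compl
    obtain ⟨F, hF, hFc⟩ := hinf.exists_subset_card_eq (t + c - S.card)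
    have hF' : ∀ v ∈ F, v ∉ eSupp H ∧ v ∉ S := by
      intro v hv
      have : v ∉ (↑(hVfin.toFinset ∪ S) : Set ℕ) := hF hv
      simpa using this
    let S' : Finset ℕ := S ∪ F
    have hS'c : S'.card = t + c := by
      rw [Finset.card_union_of_disjoint, hFc]
      · omega
      · rw [Finset.disjoint_right]
        intro v hv
        exact (hF' v hv).2
    have hXS' : Disjoint X S' := by
      rw [Finset.disjoint_left]
      intro v hv hv'
      rw [hX] at hv
      rcases Finset.mem_union.mp hv' with h | h
      · exact hv.2.2 h
      · exact (hF' v h).1 hv.1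
    have hYS' : Disjoint Y S' := by
      rw [Finset.disjoint_left]
      intro v hv hv'
      rw [hY] at hv
      rcases Finset.mem_union.mp hv' with h | h
      · exact hv.2.2 h
      · exact (hF' v h).1 hv.1
    have hXY : Disjoint X Y := by
      rw [Finset.disjoint_left]
      intro v hv hv'
      rw [hX] at hv
      rw [hY] at hv'
      exact hv'.2.1 hv.2.1
    have h2c := rk_two_cliques hd (X := X) (Y := Y) (S := S') (by have := hd.le; omega) hXY hYS'
    have hXc : M.rk (clique (↑(X ∪ S') : Set ℕ)) = M.rk (cliqueN (t + c)) + d * X.card := by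
      rw [rk_clique_card, Finset.card_union_of_disjoint hXS', hS'c, add_comm, hd.R_add (by omega)]
    have hYc : M.rk (clique (↑(Y ∪ S') : Set ℕ)) = M.rk (cliqueN (t + c)) + d * Y.card := by
      rw [rk_clique_card, Finset.card_union_of_disjoint hYS', hS'c, add_comm, hd.R_add (by omega)]
    let A : Set (Sym2 ℕ) := {e | e ∈ H ∧ ∃ v ∈ e, v ∈ P ∧ v ∉ S}
    let B : Set (Sym2 ℕ) := {e | e ∈ H ∧ ∀ v ∈ e, v ∈ P → v ∈ S}
    have hAB : A ∪ B = H := by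
      ext e
      constructor
      · rintro (h | h) <;> exact h.1
      · intro he
        by_cases h : ∃ v ∈ e, v ∈ P ∧ v ∉ S
        · exact Or.inl ⟨he, h⟩
        · refine Or.inr ⟨he, fun v hv hvP => ?_⟩
          by_contra hvS
          exact h ⟨v, hv, hvP, hvS⟩
    have hAmem : ∀ e ∈ A, ∀ w ∈ e, w ∈ S ∨ w ∈ P := by
      rintro e ⟨he, v, hv, hvP, hvS⟩ w hw
      by_cases hwS : w ∈ S
      · exact Or.inl hwS
      right
      by_cases hvw : v = w
      · exact hvw ▸ hvP
      · have : e = s(v, w) := (Sym2.mem_and_mem_iff hvw).mp ⟨hv, hw⟩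
        exact hP v w (this ▸ he) hvS hwS hvP
    have hA' : A ⊆ clique (↑(X ∪ S') : Set ℕ) := by
      intro e he
      refine ⟨hH.2 e he.1, fun w hw => ?_⟩
      rw [Finset.mem_coe, Finset.mem_union, hX, Finset.mem_union]
      have hwV : w ∈ eSupp H := ⟨e, he.1, hw⟩
      have := hAmem e he w hw
      tauto
    have hB' : B ⊆ clique (↑(Y ∪ S') : Set ℕ) := by
      intro e he
      refine ⟨hH.2 e he.1, fun w hw => ?_⟩
      rw [Finset.mem_coe, Finset.mem_union, hY, Finset.mem_union]
      have hwV : w ∈ eSupp H := ⟨e, he.1, hw⟩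
      have := he.2 w hw
      tauto
    have hlam := lam_mono (M := M) (clique_finite (Finset.finite_toSet (X ∪ S')))
      (clique_finite (Finset.finite_toSet (Y ∪ S'))) hA' hB'
    rw [hAB] at hlam
    have hdrop : ∀ z ∈ eSupp H, M.rk (deleteVerts H {z}) + 1 ≤ M.rk H := by
      intro z hz
      obtain ⟨w, hw⟩ := exists_nbr hz
      have := rk_deleteVert hd.low hH (x := z) {w} (by simpa using hw) (by simpa using hd.pos)
      simpa using this
    have hfd : ∀ z : ℕ, (deleteVerts H {z}).Finite := fun z => (isGraph_deleteVerts hH {z}).1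
    rcases hVC A B hAB (by omega) with h | h
    · have h1 := hdrop y hyV
      have h2 : M.rk A ≤ M.rk (deleteVerts H {y}) := by
        refine rk_mono (hfd y) fun e he => ⟨he.1, ?_⟩
        rintro v hv rfl
        rcases hAmem e he v hv with h | h
        exacts [hyS h, hyP h]
      omega
    · have h1 := hdrop x hxV
      have h2 : M.rk B ≤ M.rk (deleteVerts H {x}) := by
        refine rk_mono (hfd x) fun e he => ⟨he.1, ?_⟩
        rintro v hv rfl
        exact hxS (he.2 v hv hxP)
      omega

theorem exists_circuit_of_LY {c : ℕ} (h : LY M c) : ∃ C, M.M.IsCircuit C := by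
  classical
  by_contra hcon
  have hind : ∀ X, X ⊆ M.M.E → M.M.Indep X := by
    intro X hX
    by_contra hX'
    have hdep : M.M.Dep X := ⟨hX', hX⟩
    obtain ⟨C, -, hC⟩ := hdep.exists_isCircuit_subset
    exact hcon ⟨C, hC⟩
  have hrk : ∀ X, IsGraph X → M.rk X = X.ncard := by
    intro X hX
    have h1 := cast_rk (M := M) hX.1
    rw [(hind X fun e he => mem_ground.mpr (hX.2 e he)).eRk_eq_encard,
      ← hX.1.cast_ncard_eq] at h1
    exact_mod_cast h1
  let E : Set (Sym2 ℕ) := cliqueN (c + 3) \ {s(0, 1)}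
  have hE : IsGraph E := ⟨(cliqueN_finite _).subset sdiff_subset, fun e he => he.1.1⟩
  have hmem : ∀ a b, s(a, b) ∈ E ↔ (a ≠ b ∧ a < c + 3 ∧ b < c + 3) ∧ s(a, b) ≠ s(0, 1) := by
    intro a b
    have : s(a, b) ∈ E ↔ s(a, b) ∈ cliqueN (c + 3) ∧ s(a, b) ≠ s(0, 1) := Iff.rfl
    rw [this]
    unfold cliqueN
    rw [mk_mem_clique]
    rfl
  have hsupp : eSupp E = (↑(Finset.range (c + 3)) : Set ℕ) := by
    ext v
    rw [Finset.mem_coe, Finset.mem_range]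
    constructor
    · rintro ⟨e, he, hv⟩
      exact he.1.2 v hv
    · intro hv
      by_cases hv2 : v = 2
      · subst hv2
        exact ⟨s(2, 0), (hmem _ _).mpr ⟨by omega, by simp⟩, by simp⟩
      · refine ⟨s(v, 2), (hmem _ _).mpr ⟨by omega, by simp⟩, by simp⟩
  have hKC : KC c E := by
    refine ⟨by rw [hsupp, ncard_coe_finset, Finset.card_range]; omega, ?_⟩
    rintro S hS P ⟨x, hx, hxS, hxP⟩ hP y hy hyS
    rw [hsupp, Finset.mem_coe, Finset.mem_range] at hx hy
    have hz : ∃ z ∈ Finset.Ico 2 (c + 3), z ∉ S := by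
      by_contra hcon
      push Not at hcon
      have := Finset.card_le_card (show Finset.Ico 2 (c + 3) ⊆ S from hcon)
      rw [Nat.card_Ico] at this
      omega
    obtain ⟨z, hz, hzS⟩ := hz
    rw [Finset.mem_Ico] at hz
    have hzP : z ∈ P := by
      by_cases hxz : x = z
      · exact hxz ▸ hxP
      · refine hP x z ((hmem _ _).mpr ⟨by omega, ?_⟩) hxS hzS hxP
        simp; omega
    by_cases hyz : z = y
    · exact hyz ▸ hzP
    · refine hP z y ((hmem _ _).mpr ⟨by omega, ?_⟩) hzS hyS hzP
      simp; omega
  have hrig := h E hE hKC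
  unfold Rigid at hrig
  rw [hrk E hE, hrk _ ⟨clique_finite (eSupp_finite hE.1), fun e he => he.1⟩, hsupp] at hrig
  have hlt : E.ncard < (clique (↑(Finset.range (c + 3)) : Set ℕ)).ncard := by
    refine ncard_lt_ncard ?_ (clique_finite (Finset.finite_toSet _))
    refine ⟨hsupp ▸ subset_clique hE, fun hsub => ?_⟩
    have : s(0, 1) ∈ E := hsub (mk_mem_clique.mpr ⟨by omega, by simp, by simp⟩)
    exact this.2 rfl
  omega

end GraphMatroidFamily

namespace GraphMatroidFamily
open Set

variable {M : GraphMatroidFamily}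

theorem vc_iso {k : ℕ} {G : Set (Sym2 ℕ)} {ψ : Sym2 ℕ → Sym2 ℕ} (hinj : InjOn ψ G)
    (hψ : ∀ S ⊆ G, (M.M.Indep S ↔ M.M.Indep (ψ '' S))) (h : VC M k G) : VC M k (ψ '' G) := by
  intro A B hAB hlt
  have himg : ∀ A, A ⊆ ψ '' G → ψ '' (G ∩ ψ ⁻¹' A) = A := by
    intro A hA
    ext e
    constructor
    · rintro ⟨f, hf, rfl⟩
      exact hf.2
    · intro he
      obtain ⟨f, hf, rfl⟩ := hA he
      exact ⟨f, ⟨hf, he⟩, rfl⟩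
  have hA := himg A (hAB ▸ subset_union_left)
  have hB := himg B (hAB ▸ subset_union_right)
  have hu : (G ∩ ψ ⁻¹' A) ∪ (G ∩ ψ ⁻¹' B) = G := by
    ext f
    constructor
    · rintro (h | h) <;> exact h.1
    · intro hf
      have : ψ f ∈ A ∪ B := hAB ▸ mem_image_of_mem ψ hf
      rcases this with h | h
      · exact Or.inl ⟨hf, h⟩
      · exact Or.inr ⟨hf, h⟩
  have hrA := rk_iso hinj hψ (S := G ∩ ψ ⁻¹' A) inter_subset_left
  have hrB := rk_iso hinj hψ (S := G ∩ ψ ⁻¹' B) inter_subset_left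
  have hrG := rk_iso hinj hψ (S := G) Subset.rfl
  rw [hA] at hrA
  rw [hB] at hrB
  have := h _ _ hu (by omega)
  omega

theorem iso_card {c c' d t : ℕ} (hd : Dim M d t) (hLY : LY M c)
    (hc' : c + t + d * (M.rk (cliqueN (t + c)) + 1) + 2 * (M.rk (cliqueN (t + c)) + 1) + 2 * d + 5
      ≤ c')
    {G : Set (Sym2 ℕ)} (hG : IsGraph G) (hKC : KC c' G) {ψ : Sym2 ℕ → Sym2 ℕ} (hinj : InjOn ψ G)
    (hψ : ∀ S ⊆ G, (M.M.Indep S ↔ M.M.Indep (ψ '' S))) (hH : IsGraph (ψ '' G)) :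
    M.rk G = M.rk (cliqueN (eSupp G).ncard) ∧ (eSupp (ψ '' G)).ncard = (eSupp G).ncard := by
  have hr := rk_of_rigid hG (hLY G hG (hKC.mono (by omega)))
  refine ⟨hr, ?_⟩
  have hn := hKC.1
  have h1 := hd.R_add (n := t + c) (by omega) 1
  have h2 := R_mono (M := M) (show t + c + 1 ≤ (eSupp G).ncard by omega)
  have hp := hd.pos
  have hrG := rk_iso hinj hψ (S := G) Subset.rfl
  have hK : KC c (ψ '' G) := kc_of_vc hd hH (vc_iso hinj hψ (vc_of_kc hd hLY hc' hG hKC))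
    (by omega) (by omega)
  have hr' := rk_of_rigid hH (hLY _ hH hK)
  exact hd.card_eq (t := t) (by omega) (by omega)

theorem whitney_of_LY (hM : M.Unbounded) {c : ℕ} (hLY : LY M c) : ∃ c', ∀ E : Set (Sym2 ℕ),
    IsGraph E → KC c' E → M.Reconstructible E := by
  classical
  obtain ⟨d, t, hd⟩ := exists_Dim hM (exists_circuit_of_LY hLY)
  obtain ⟨c', hc'⟩ : ∃ c', c' = c + t + d * (M.rk (cliqueN (t + c)) + 1) +
    2 * (M.rk (cliqueN (t + c)) + 1) + 2 * d + 5 := ⟨_, rfl⟩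
  refine ⟨c' + 1, ?_⟩
  rintro G hG hKC H hH ψ ⟨hbij, hψ⟩
  have hinj := hbij.injOn
  have hGH : ψ '' G = H := hbij.image_eq
  subst hGH
  obtain ⟨hrG, hcard⟩ := iso_card hd hLY hc'.ge hG (hKC.mono (by omega)) hinj hψ hH
  have hVfin := eSupp_finite hG.1
  have hWfin := eSupp_finite hH.1
  have key : ∀ v, v ∈ eSupp G → ∃ w ∈ eSupp (ψ '' G), ∀ f ∈ G, (v ∈ f ↔ w ∈ ψ f) := by
    intro v hv
    have hdel : deleteVerts G {v} = deleteVerts G (↑({v} : Finset ℕ)) := by simp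
    have hsub : deleteVerts G {v} ⊆ G := deleteVerts_subset _ _
    have hG' := isGraph_deleteVerts hG {v}
    have hK' : KC c' (deleteVerts G {v}) := by
      rw [hdel]
      exact hKC.delete hG.1 {v} (by simp; omega) (by simp; omega)
    have hsG' : (eSupp (deleteVerts G {v})).ncard = (eSupp G).ncard - 1 := by
      rw [hdel, hKC.eSupp_delete {v} (by simp; omega), Finset.coe_singleton,
        ncard_sdiff_singleton_of_mem hv]
    have hH' : IsGraph (ψ '' deleteVerts G {v}) :=
      ⟨hG'.1.image _, fun e he => hH.2 e (image_mono hsub he)⟩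
    obtain ⟨hr', hcard'⟩ := iso_card hd hLY hc'.ge hG' hK' (hinj.mono hsub)
      (fun S hS => hψ S (hS.trans hsub)) hH'
    have hss : eSupp (ψ '' deleteVerts G {v}) ⊆ eSupp (ψ '' G) := eSupp_mono (image_mono hsub)
    have hn := hKC.1
    obtain ⟨w, hwH, hwH'⟩ := exists_mem_notMem_of_ncard_lt_ncard
      (s := eSupp (ψ '' deleteVerts G {v})) (t := eSupp (ψ '' G)) (by omega)
      (eSupp_finite hH'.1)
    have heq : eSupp (ψ '' deleteVerts G {v}) = eSupp (ψ '' G) \ {w} := by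
      refine eq_of_subset_of_ncard_le (fun z hz => ⟨hss hz, ?_⟩) ?_ hWfin.sdiff
      · rintro rfl; exact hwH' hz
      · rw [ncard_sdiff_singleton_of_mem hwH]; omega
    refine ⟨w, hwH, fun f hf => ⟨fun hvf => ?_, fun hwf => ?_⟩⟩
    · by_contra hwf
      have hvG' : v ∉ eSupp (deleteVerts G {v}) := by
        rintro ⟨e, he, hve⟩
        exact he.2 v hve rfl
      obtain ⟨u, rfl⟩ := Sym2.mem_iff_exists.mp hvf
      have h1 := rk_insert hG'.1 (hG.2 _ hf) (pendant_notMem_closure hM (y := u) hvG')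
      have h2 := rk_iso hinj hψ (S := insert s(v, u) (deleteVerts G {v})) (insert_subset hf hsub)
      have h3 : ψ '' insert s(v, u) (deleteVerts G {v}) ⊆
          clique (eSupp (ψ '' deleteVerts G {v})) := by
        rw [image_insert_eq]
        refine insert_subset ⟨hH.2 _ (mem_image_of_mem ψ hf), fun z hz => ?_⟩ (subset_clique hH')
        rw [heq]
        refine ⟨⟨_, mem_image_of_mem ψ hf, hz⟩, ?_⟩
        rintro rfl
        exact hwf hz
      have h4 := rk_mono (M := M) (clique_finite (eSupp_finite hH'.1)) h3
      rw [rk_clique_ncard (eSupp_finite hH'.1), hcard'] at h4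
      omega
    · by_contra hvf
      refine hwH' ⟨ψ f, mem_image_of_mem ψ ⟨hf, ?_⟩, hwf⟩
      rintro z hz rfl
      exact hvf hz
  choose! φ hφ hφ' using key
  have hφinj : InjOn φ (eSupp G) := by
    intro u hu v hv huv
    by_contra hne
    have : ∃ a, s(u, a) ∈ G ∧ a ≠ v := by
      by_contra hcon
      push Not at hcon
      have := hKC.deg hu {v} (fun a ha => by simpa using hcon a ha)
      simp at this
      omega
    obtain ⟨a, ha, hav⟩ := this
    have h1 := (hφ' u hu _ ha).mp (by simp)
    rw [huv] at h1
    have h2 := (hφ' v hv _ ha).mpr h1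
    rw [Sym2.mem_iff] at h2
    rcases h2 with h | h
    · exact hne h.symm
    · exact hav h.symm
  have himg : φ '' eSupp G = eSupp (ψ '' G) := by
    refine eq_of_subset_of_ncard_le ?_ ?_ hWfin
    · rintro _ ⟨v, hv, rfl⟩
      exact hφ v hv
    · rw [hφinj.ncard_image, hcard]
  refine ⟨φ, ⟨fun v hv => hφ v hv, hφinj, himg.ge⟩, ?_⟩
  intro e he
  induction e with
  | _ u v =>
  have hu : u ∈ eSupp G := ⟨_, he, by simp⟩
  have hv : v ∈ eSupp G := ⟨_, he, by simp⟩
  have huv : u ≠ v := by simpa using hG.2 _ he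
  have hne : φ u ≠ φ v := fun h => huv (hφinj hu hv h)
  rw [Sym2.map_mk]
  exact (Sym2.mem_and_mem_iff hne).mp
    ⟨(hφ' u hu _ he).mp (by simp), (hφ' v hv _ he).mp (by simp)⟩

theorem LY_of_whitney (hM : M.Unbounded) {c : ℕ} (hW : ∀ E : Set (Sym2 ℕ),
    IsGraph E → KC c E → M.Reconstructible E) : LY M c := by
  classical
  intro E hE hKC
  have hVfin := eSupp_finite hE.1
  by_contra hnr
  have hex : ∃ e ∈ clique (eSupp E), e ∉ M.M.closure E := by
    by_contra hcon
    push Not at hcon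
    exact hnr (le_antisymm (rk_mono (clique_finite hVfin) (subset_clique hE))
      (rk_closure_le hE.1 (clique_finite hVfin) hcon))
  obtain ⟨e, he, hecl⟩ := hex
  have hEgr : E ⊆ M.M.E := fun f hf => mem_ground.mpr (hE.2 f hf)
  have heE : e ∉ E := fun h => hecl (M.M.subset_closure E hEgr h)
  obtain ⟨u, hu⟩ : (eSupp E).Nonempty := by
    rw [← ncard_pos hVfin]; have := hKC.1; omega
  obtain ⟨w, hw⟩ := hVfin.exists_notMem
  have hwu : w ≠ u := by rintro rfl; exact hw hu
  have hfcl : s(w, u) ∉ M.M.closure E := pendant_notMem_closure hM hw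
  have hfE : s(w, u) ∉ E := fun h => hw ⟨_, h, by simp⟩
  have hsG : eSupp (insert e E) = eSupp E := by
    refine Subset.antisymm ?_ (eSupp_mono (subset_insert _ _))
    rintro v ⟨f, hf, hv⟩
    rcases hf with rfl | hf
    · exact he.2 v hv
    · exact ⟨f, hf, hv⟩
  have hsH : insert w (eSupp E) ⊆ eSupp (insert s(w, u) E) :=
    insert_subset ⟨s(w, u), mem_insert _ _, by simp⟩ (eSupp_mono (subset_insert _ _))
  have hG : IsGraph (insert e E) := ⟨hE.1.insert _, by
    rintro f (rfl | hf)
    exacts [he.1, hE.2 f hf]⟩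
  have hH : IsGraph (insert s(w, u) E) := ⟨hE.1.insert _, by
    rintro f (rfl | hf)
    exacts [by simpa using hwu, hE.2 f hf]⟩
  have hKG : KC c (insert e E) := by
    refine ⟨by rw [hsG]; exact hKC.1, ?_⟩
    intro S hS P hx hP
    rw [hsG] at hx ⊢
    exact hKC.2 S hS P hx fun a b hab => hP a b (Or.inr hab)
  let ψ : Sym2 ℕ → Sym2 ℕ := fun f => if f = e then s(w, u) else f
  have hψe : ψ e = s(w, u) := by simp [ψ]
  have hψE : ∀ f ∈ E, ψ f = f := by
    intro f hf
    have : f ≠ e := by rintro rfl; exact heE hf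
    simp [ψ, this]
  have hψS : ∀ S ⊆ E, ψ '' S = S := by
    intro S hS
    ext f
    constructor
    · rintro ⟨g, hg, rfl⟩
      rw [hψE g (hS hg)]; exact hg
    · intro hf
      exact ⟨f, hf, hψE f (hS hf)⟩
  have hins : ∀ g, g ∈ M.M.E → g ∉ M.M.closure E → ∀ S ⊆ E,
      (M.M.Indep (insert g S) ↔ M.M.Indep S) := by
    intro g hg hgcl S hS
    refine ⟨fun h => h.subset (subset_insert _ _), fun h => ?_⟩
    rw [h.insert_indep_iff]
    exact Or.inl ⟨hg, fun h' => hgcl (M.M.closure_subset_closure hS h')⟩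
  have hiso : M.MatroidIso (insert e E) (insert s(w, u) E) ψ := by
    refine ⟨⟨?_, ?_, ?_⟩, ?_⟩
    · rintro f (rfl | hf)
      · rw [hψe]; exact mem_insert _ _
      · rw [hψE f hf]; exact Or.inr hf
    · rintro f (rfl | hf) g (rfl | hg) hfg
      · rfl
      · rw [hψe, hψE g hg] at hfg
        exact absurd (hfg ▸ hg) hfE
      · rw [hψe, hψE f hf] at hfg
        exact absurd (hfg ▸ hf) hfE
      · rwa [hψE f hf, hψE g hg] at hfg
    · rintro f (rfl | hf)
      · exact ⟨e, mem_insert _ _, hψe⟩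
      · exact ⟨f, Or.inr hf, hψE f hf⟩
    · intro S hS
      by_cases heS : e ∈ S
      · have hS' : S \ {e} ⊆ E := by
          rintro f ⟨hf, hfe⟩
          rcases hS hf with h | h
          · exact absurd h hfe
          · exact h
        have hSe : S = insert e (S \ {e}) := by
          rw [insert_sdiff_singleton, insert_eq_of_mem heS]
        have h2 : ψ '' S = insert s(w, u) (S \ {e}) := by
          conv_lhs => rw [hSe]
          rw [image_insert_eq, hψe, hψS _ hS']
        have h3 := hins e (mem_ground.mpr he.1) hecl _ hS'
        have h4 := hins s(w, u) (mem_ground.mpr (hH.2 _ (mem_insert _ _))) hfcl _ hS'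
        rw [← hSe] at h3
        rw [← h2] at h4
        exact h3.trans h4.symm
      · have hS' : S ⊆ E := by
          intro f hf
          rcases hS hf with rfl | h
          · exact absurd hf heS
          · exact h
        rw [hψS S hS']
  obtain ⟨φ, hφ, -⟩ := hW _ hG hKG _ hH ψ hiso
  have h1 : (eSupp (insert s(w, u) E)).ncard ≤ (eSupp E).ncard := by
    rw [← hφ.image_eq, ← hsG]
    exact ncard_image_le (eSupp_finite hG.1)
  have h2 := ncard_le_ncard hsH (eSupp_finite hH.1)
  rw [ncard_insert_of_notMem hw hVfin] at h2
  omega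

end GraphMatroidFamily

/-- An unbounded graph matroid family has the Whitney property
if and only if it has the Lovász–Yemini property. -/
theorem whitney_iff_lovaszYemini (M : GraphMatroidFamily) (hM : M.Unbounded) :
    M.Whitney ↔ M.LovaszYemini := by
  constructor
  · rintro ⟨c, hc⟩
    have h := GraphMatroidFamily.LY_of_whitney hM (c := c)
      (fun E hE hK => hc E hE ((GraphMatroidFamily.kc_iff hE c).mpr hK))
    exact ⟨c, fun E hE hK => h E hE ((GraphMatroidFamily.kc_iff hE c).mp hK)⟩
  · rintro ⟨c, hc⟩
    obtain ⟨c', h⟩ := GraphMatroidFamily.whitney_of_LY hM (c := c)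
      (fun E hE hK => hc E hE ((GraphMatroidFamily.kc_iff hE c).mpr hK))
    exact ⟨c', fun E hE hK => h E hE ((GraphMatroidFamily.kc_iff hE c').mp hK)⟩
end

section
/- Let M be a graph matroid family. If M is 1-extendable, then M has the Lovász-Yemini property. -/
open Finset in
theorem ly_swap_count (S : Finset (Equiv.Perm ℕ)) (V W : Finset ℕ) (hW : W ⊆ V)
    (hS : ∀ σ ∈ S, ∀ u ∈ V, ∀ v ∈ V, σ * Equiv.swap u v ∈ S)
    (P : Equiv.Perm ℕ → ℕ → Prop) [∀ σ u, Decidable (P σ u)]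
    (hP : ∀ σ, ∀ u ∈ W, ∀ v ∈ W, P (σ * Equiv.swap u v) v ↔ P σ u) (v : ℕ) (hv : v ∈ W) :
    #W * #{σ ∈ S | P σ v} = ∑ σ ∈ S, #{u ∈ W | P σ u} := by
  have h1 : ∑ σ ∈ S, #{u ∈ W | P σ u} = ∑ u ∈ W, #{σ ∈ S | P σ u} := by
    simp only [Finset.card_filter]
    exact Finset.sum_comm
  rw [h1, Finset.sum_const_nat (m := #{σ ∈ S | P σ v})]
  intro u hu
  refine Finset.card_bij' (fun σ _ => σ * Equiv.swap u v) (fun σ _ => σ * Equiv.swap u v)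
    ?_ ?_ ?_ ?_
  · intro σ hσ
    rw [Finset.mem_filter] at hσ ⊢
    exact ⟨hS σ hσ.1 u (hW hu) v (hW hv), (hP σ u hu v hv).2 hσ.2⟩
  · intro σ hσ
    rw [Finset.mem_filter] at hσ ⊢
    refine ⟨hS σ hσ.1 u (hW hu) v (hW hv), ?_⟩
    rw [Equiv.swap_comm]
    exact (hP σ v hv u hu).2 hσ.2
  · intro σ _; simp [mul_assoc]
  · intro σ _; simp [mul_assoc]

theorem ly_exists_perms (V : Finset ℕ) : ∃ S : Finset (Equiv.Perm ℕ), S.Nonempty ∧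
    ∀ σ ∈ S, ∀ u ∈ V, ∀ v ∈ V, σ * Equiv.swap u v ∈ S := by
  classical
  refine ⟨(Finset.univ : Finset (Equiv.Perm {x // x ∈ V})).image
    (fun σ => Equiv.Perm.ofSubtype σ), ⟨_, Finset.mem_image_of_mem _ (Finset.mem_univ 1)⟩, ?_⟩
  intro σ hσ u hu v hv
  obtain ⟨τ, -, rfl⟩ := Finset.mem_image.1 hσ
  refine Finset.mem_image.2 ⟨τ * Equiv.swap ⟨u, hu⟩ ⟨v, hv⟩, Finset.mem_univ _, ?_⟩
  rw [map_mul, Equiv.Perm.ofSubtype_swap_eq]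

open Finset in
theorem ly_count_bad (S : Finset (Equiv.Perm ℕ)) (V W : Finset ℕ) (hW : W ⊆ V)
    (hS : ∀ σ ∈ S, ∀ u ∈ V, ∀ v ∈ V, σ * Equiv.swap u v ∈ S) (v : ℕ) (hv : v ∈ W) (d : ℕ) :
    #W * #{σ ∈ S | #{w ∈ W | σ w < σ v} ≤ d} ≤ (d + 1) * #S := by
  rw [ly_swap_count S V W hW hS (fun σ v => #{w ∈ W | σ w < σ v} ≤ d) ?_ v hv]
  · rw [mul_comm, ← smul_eq_mul]
    refine Finset.sum_le_card_nsmul _ _ _ ?_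
    intro σ _
    have : #{u ∈ W | #{w ∈ W | σ w < σ u} ≤ d} ≤ #(Finset.range (d + 1)) := by
      refine Finset.card_le_card_of_injOn (fun u => #{w ∈ W | σ w < σ u}) ?_ ?_
      · intro u hu
        simp only [Finset.coe_filter, Set.mem_ofPred_eq] at hu
        simp only [Finset.coe_range, Set.mem_Iio]
        omega
      · have key : ∀ u ∈ W, ∀ u' ∈ W, σ u < σ u' →
            #{w ∈ W | σ w < σ u} < #{w ∈ W | σ w < σ u'} := by
          intro u hu u' hu' hlt
          apply Finset.card_lt_card
          rw [Finset.ssubset_iff_of_subset]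
          · exact ⟨u, by simp [hu, hlt], by simp⟩
          · intro w hw
            simp only [Finset.mem_filter] at hw ⊢
            exact ⟨hw.1, hw.2.trans hlt⟩
        intro u hu u' hu' he
        simp only [Finset.coe_filter, Set.mem_ofPred_eq] at hu hu' he
        rcases lt_trichotomy (σ u) (σ u') with h | h | h
        · have := key u hu.1 u' hu'.1 h; omega
        · exact σ.injective h
        · have := key u' hu'.1 u hu.1 h; omega
    simpa using this
  · intro σ u hu v hv
    have : #{w ∈ W | (σ * Equiv.swap u v) w < (σ * Equiv.swap u v) v}
        = #{w ∈ W | σ w < σ u} := by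
      have hsw : ∀ w ∈ W, Equiv.swap u v w ∈ W := by
        intro w hw
        rw [Equiv.swap_apply_def]
        split_ifs <;> assumption
      refine Finset.card_bij' (fun w _ => Equiv.swap u v w) (fun w _ => Equiv.swap u v w)
        ?_ ?_ ?_ ?_
      · intro w hw
        simp only [Finset.mem_filter, Equiv.Perm.mul_apply, Equiv.swap_apply_right] at hw ⊢
        exact ⟨hsw w hw.1, hw.2⟩
      · intro w hw
        simp only [Finset.mem_filter, Equiv.Perm.mul_apply, Equiv.swap_apply_right] at hw ⊢
        exact ⟨hsw w hw.1, by simpa using hw.2⟩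
      · intro w _; simp
      · intro w _; simp
    rw [this]

open Finset in
theorem ly_count_good (S : Finset (Equiv.Perm ℕ)) (V : Finset ℕ)
    (hS : ∀ σ ∈ S, ∀ u ∈ V, ∀ v ∈ V, σ * Equiv.swap u v ∈ S) (v x y : ℕ)
    (hv : v ∈ V) (hx : x ∈ V) (hy : y ∈ V) (hvx : v ≠ x) (hvy : v ≠ y) :
    #S ≤ 3 * #{σ ∈ S | σ x < σ v ∧ σ y < σ v} := by
  have hW : ({v, x, y} : Finset ℕ) ⊆ V := by
    intro z hz
    simp only [Finset.mem_insert, Finset.mem_singleton] at hz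
    rcases hz with rfl | rfl | rfl <;> assumption
  have h := ly_swap_count S V {v, x, y} hW hS
    (fun σ u => ∀ w ∈ ({v, x, y} : Finset ℕ), σ w ≤ σ u) ?_ v (by simp)
  · have h3 : #({v, x, y} : Finset ℕ) ≤ 3 := Finset.card_le_three
    have h1 : #S ≤ ∑ σ ∈ S, #{u ∈ ({v, x, y} : Finset ℕ) |
        ∀ w ∈ ({v, x, y} : Finset ℕ), σ w ≤ σ u} := by
      rw [Finset.card_eq_sum_ones]
      refine Finset.sum_le_sum fun σ _ => ?_
      obtain ⟨u, hu, hm⟩ := Finset.exists_max_image ({v, x, y} : Finset ℕ) σ ⟨v, by simp⟩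
      exact Finset.card_pos.2 ⟨u, Finset.mem_filter.2 ⟨hu, hm⟩⟩
    have h2 : #{σ ∈ S | ∀ w ∈ ({v, x, y} : Finset ℕ), σ w ≤ σ v}
        ≤ #{σ ∈ S | σ x < σ v ∧ σ y < σ v} := by
      apply Finset.card_le_card
      intro σ hσ
      simp only [Finset.mem_filter, Finset.mem_insert, Finset.mem_singleton, forall_eq_or_imp,
        forall_eq] at hσ ⊢
      refine ⟨hσ.1, lt_of_le_of_ne hσ.2.2.1 ?_, lt_of_le_of_ne hσ.2.2.2 ?_⟩
      · intro h; exact hvx (σ.injective h).symm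
      · intro h; exact hvy (σ.injective h).symm
    calc #S ≤ _ := h1
      _ = _ := h.symm
      _ ≤ _ := Nat.mul_le_mul h3 h2
  · intro σ u hu v' hv'
    have hsw : ∀ w ∈ ({v, x, y} : Finset ℕ), Equiv.swap u v' w ∈ ({v, x, y} : Finset ℕ) := by
      intro w hw
      rw [Equiv.swap_apply_def]
      split_ifs <;> assumption
    simp only [Equiv.Perm.mul_apply, Equiv.swap_apply_right]
    constructor
    · intro h w hw
      simpa using h _ (hsw w hw)
    · intro h w hw
      exact h _ (hsw w hw)

theorem ly_exists_perm (s : Finset ℕ) (f : ℕ → ℕ) (hf : Set.InjOn f s) :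
    ∃ σ : Equiv.Perm ℕ, ∀ x ∈ s, σ x = f x := by
  obtain ⟨σ, h⟩ := Equiv.Perm.exists_extending_pair (fun i : s => (i : ℕ)) (fun i : s => f i)
    Subtype.val_injective (fun i j h => Subtype.ext (hf i.2 j.2 h))
  exact ⟨σ, fun x hx => h ⟨x, hx⟩⟩

theorem ly_exists_inj (B Q : Finset ℕ) (h : B.card ≤ Q.card) :
    ∃ g : ℕ → ℕ, Set.InjOn g B ∧ ∀ x ∈ B, g x ∈ Q := by
  classical
  obtain ⟨e⟩ := Function.Embedding.nonempty_of_card_le (α := B) (β := Q) (by simpa using h)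
  refine ⟨fun x => if hx : x ∈ B then (e ⟨x, hx⟩ : ℕ) else 0, ?_, ?_⟩
  · intro x hx y hy hxy
    have hx' : x ∈ B := hx
    have hy' : y ∈ B := hy
    simp only [hx', hy', dif_pos] at hxy
    have := e.injective (Subtype.ext hxy)
    simpa using this
  · intro x hx
    simp [hx]

theorem ly_perm_parts (A B A' V : Finset ℕ) (p v : ℕ) (hAB : Disjoint A B) (hpA : p ∉ A)
    (hpB : p ∉ B) (hA' : A' ⊆ V) (hv : v ∉ V) (hc : A.card = A'.card)
    (hc2 : A.card + B.card ≤ V.card) :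
    ∃ σ : Equiv.Perm ℕ, σ p = v ∧ (∀ x ∈ A, σ x ∈ A') ∧ (∀ y ∈ A', ∃ x ∈ A, σ x = y) ∧
      ∀ x ∈ B, σ x ∈ V := by
  classical
  obtain ⟨f, hf, hf'⟩ := ly_exists_inj A A' hc.le
  obtain ⟨g, hg, hg'⟩ := ly_exists_inj B (V \ A') (by
    rw [Finset.card_sdiff_of_subset hA']; omega)
  have hAB' := Finset.disjoint_left.1 hAB
  obtain ⟨σ, hσ⟩ := ly_exists_perm (insert p (A ∪ B))
    (fun x => if x ∈ A then f x else if x ∈ B then g x else v) (by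
      intro x hx y hy hxy
      simp only [Finset.coe_insert, Finset.coe_union, Set.mem_insert_iff, Set.mem_union,
        Finset.mem_coe] at hx hy
      simp only [Finset.mem_sdiff] at hg'
      have hgx := hg' x
      have hgy := hg' y
      have hfx := hf' x
      have hfy := hf' y
      have hVx := @hA' (f x)
      have hVy := @hA' (f y)
      have i1 := @hf x
      have i2 := @hg x
      simp only [Finset.mem_coe] at i1 i2
      dsimp only at hxy
      split_ifs at hxy <;> grind)
  have h1 : ∀ x ∈ A, σ x = f x := fun x hx => by rw [hσ x (by simp [hx])]; simp [hx]
  have h2 : ∀ x ∈ B, σ x = g x := fun x hx => by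
    rw [hσ x (by simp [hx])]
    have : x ∉ A := fun h => hAB' h hx
    simp [hx, this]
  refine ⟨σ, ?_, fun x hx => by rw [h1 x hx]; exact hf' x hx, ?_, fun x hx => ?_⟩
  · rw [hσ p (by simp)]; simp [hpA, hpB]
  · intro y hy
    have := Finset.surj_on_of_inj_on_of_card_le (s := A) (t := A') (fun x _ => f x) hf'
      (fun a b ha hb h => hf ha hb h) hc.ge y hy
    obtain ⟨x, hx, h⟩ := this
    exact ⟨x, hx, by rw [h1 x hx, h]⟩
  · rw [h2 x hx]; exact (Finset.mem_sdiff.1 (hg' x hx)).1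

/-- The star with centre `v` and leaves `D`. -/
def lyStar (v : ℕ) (D : Finset ℕ) : Set (Sym2 ℕ) := (fun x => s(v, x)) '' ↑D

theorem lyStar_finite (v : ℕ) (D : Finset ℕ) : (lyStar v D).Finite :=
  D.finite_toSet.image _

theorem ly_inj_star (v : ℕ) : Function.Injective (fun x => s(v, x)) := by
  intro x y h
  have h' : s(v, x) = s(v, y) := h
  exact Sym2.congr_right.1 h'

theorem lyStar_ncard (v : ℕ) (D : Finset ℕ) : (lyStar v D).ncard = D.card := by
  rw [lyStar, Set.ncard_image_of_injective _ (ly_inj_star v), Set.ncard_coe_finset]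

theorem lyStar_encard (v : ℕ) (D : Finset ℕ) : (lyStar v D).encard = D.card := by
  rw [← lyStar_ncard v D, (lyStar_finite v D).cast_ncard_eq]

theorem ly_clique_ground (M : GraphMatroidFamily) (V : Set ℕ) : clique V ⊆ M.M.E := by
  rw [M.ground_eq]
  exact fun e he => he.1

theorem ly_clique_finite (V : Finset ℕ) :
    (clique (V : Set ℕ)).Finite ∧ (clique (V : Set ℕ)).encard ≤ V.card * V.card := by
  have hsub : clique (V : Set ℕ) ⊆ ((V ×ˢ V).image (fun p => s(p.1, p.2)) : Finset (Sym2 ℕ)) := by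
    intro e he
    induction e using Sym2.ind with
    | _ x y =>
      have hx := he.2 x (by simp)
      have hy := he.2 y (by simp)
      simp only [Finset.coe_image, Set.mem_image, Finset.mem_coe, Finset.mem_product]
      exact ⟨(x, y), ⟨hx, hy⟩, rfl⟩
  refine ⟨(Finset.finite_toSet _).subset hsub, (Set.encard_le_encard hsub).trans ?_⟩
  rw [Set.encard_coe_eq_coe_finsetCard]
  have : ((V ×ˢ V).image (fun p => s(p.1, p.2))).card ≤ V.card * V.card :=
    Finset.card_image_le.trans (by rw [Finset.card_product])
  exact_mod_cast this

theorem ly_mem_clique {V : Set ℕ} {x y : ℕ} : s(x, y) ∈ clique V ↔ x ≠ y ∧ x ∈ V ∧ y ∈ V := by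
  simp [clique]

theorem ly_deg_pos {C : Set (Sym2 ℕ)} (hC : C.Finite) {v : ℕ} (hv : v ∈ eSupp C) :
    0 < deg C v := by
  obtain ⟨e, he, hve⟩ := hv
  exact (Set.ncard_pos (hC.subset (Set.sep_subset _ _))).2 ⟨e, he, hve⟩

theorem ly_zero_ext (M : GraphMatroidFamily) (d : ℕ) (hd : M.IsDimensionality d)
    (I : Set (Sym2 ℕ)) (hI : M.M.Indep I) (v : ℕ) (hv : v ∉ eSupp I) (D : Finset ℕ)
    (hvD : v ∉ D) (hD : D.card ≤ d) : M.M.Indep (I ∪ lyStar v D) := by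
  have := M.finitary
  have hg : I ∪ lyStar v D ⊆ M.M.E := by
    refine Set.union_subset hI.subset_ground ?_
    rw [M.ground_eq]
    rintro e ⟨x, hx, rfl⟩
    simp only [Set.mem_ofPred_eq, Sym2.mk_isDiag_iff]
    rintro rfl
    exact hvD hx
  by_contra hn
  obtain ⟨C, hC, hcirc⟩ := ((Matroid.not_indep_iff hg).1 hn).exists_isCircuit_subset
  have hCfin := hcirc.finite
  have hvC : v ∈ eSupp C := by
    by_contra hvC
    refine hcirc.not_indep (hI.subset fun e he => ?_)
    rcases hC he with h | ⟨x, hx, rfl⟩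
    · exact h
    · exact absurd ⟨_, he, by simp⟩ hvC
  have hMC : M.IsCircuit C := by
    refine ⟨⟨hCfin, fun e he => ?_⟩, hcirc.not_indep, fun e he => hcirc.sdiff_singleton_indep he⟩
    have := hcirc.subset_ground he
    rw [M.ground_eq] at this
    exact this
  have hdeg : deg C v ≤ d := by
    refine le_trans ?_ hD
    rw [← lyStar_ncard v D]
    refine Set.ncard_le_ncard ?_ (lyStar_finite v D)
    rintro e ⟨he, hve⟩
    rcases hC he with h | h
    · exact absurd ⟨e, h, hve⟩ hv
    · exact h
  obtain ⟨v0, hv0, h0⟩ : minDeg C ∈ {k : ℕ | ∃ v ∈ eSupp C, deg C v = k} :=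
    Nat.sInf_mem ⟨_, v, hvC, rfl⟩
  have hpos := ly_deg_pos hCfin hv0
  have hle : minDeg C ≤ deg C v := Nat.sInf_le ⟨v, hvC, rfl⟩
  have := hd.2 (show minDeg C - 1 ∈ {d : ℕ | ∃ C, M.IsCircuit C ∧ minDeg C = d + 1} from
    ⟨C, hMC, by omega⟩)
  omega

theorem ly_eSupp_finite {I : Set (Sym2 ℕ)} (hI : I.Finite) : (eSupp I).Finite := by
  have : eSupp I = ⋃ e ∈ I, {v | v ∈ e} := by
    ext v; simp [eSupp]
  rw [this]
  refine hI.biUnion fun e _ => ?_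
  induction e using Sym2.ind with
  | _ x y =>
    refine (Set.toFinite {x, y}).subset ?_
    intro v hv
    simpa using hv

theorem ly_one_ext (M : GraphMatroidFamily) (d : ℕ) (hd0 : 0 < d) (hd : M.IsDimensionality d)
    (hext : ∀ G G' : Set (Sym2 ℕ), IsGraph G → M.Indep G → EdgeSplit d G G' → M.Indep G')
    (I : Set (Sym2 ℕ)) (hIf : I.Finite) (u v w : ℕ) (huv : s(u, v) ∉ I)
    (hI : M.M.Indep (insert s(u, v) I)) (hw : w ∉ eSupp I) (hwu : w ≠ u) (hwv : w ≠ v)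
    (X : Finset ℕ) (huX : u ∉ X) (hvX : v ∉ X) (hwX : w ∉ X) (hX : X.card = d - 1) :
    M.M.Indep (I ∪ lyStar w (insert u (insert v X))) := by
  classical
  have hfin : (eSupp (insert s(u, v) I) ∪ {w} ∪ (X : Set ℕ)).Finite :=
    ((ly_eSupp_finite (hIf.insert _)).union (Set.finite_singleton w)).union X.finite_toSet
  obtain ⟨z, hz⟩ := hfin.exists_notMem
  simp only [Set.mem_union, Set.mem_singleton_iff, Finset.mem_coe, not_or] at hz
  obtain ⟨⟨hz1, hz2⟩, hz3⟩ := hz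
  have h1 := ly_zero_ext M d hd _ hI z hz1 X hz3 (by omega)
  have hgr : IsGraph (insert s(u, v) I ∪ lyStar z X) := by
    refine ⟨(hIf.insert _).union (lyStar_finite z X), fun e he => ?_⟩
    have := h1.subset_ground he
    rw [M.ground_eq] at this
    exact this
  have h2 := hext _ ((insert s(u, v) I ∪ lyStar z X) \ {s(u, v)} ∪ {s(w, u), s(w, v)} ∪
    ((fun x => s(w, x)) '' ↑X)) hgr h1 ⟨u, v, w, X, Or.inl (Set.mem_insert _ _), ?_, ?_, hX, huX,
      hvX, rfl⟩
  · refine Matroid.Indep.subset h2 ?_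
    rintro e (he | ⟨x, hx, rfl⟩)
    · refine Or.inl (Or.inl ⟨Or.inl (Set.mem_insert_of_mem _ he), ?_⟩)
      rintro rfl
      exact huv he
    · simp only [Finset.coe_insert, Set.mem_insert_iff, Finset.mem_coe] at hx
      rcases hx with rfl | rfl | hx
      · exact Or.inl (Or.inr (by simp))
      · exact Or.inl (Or.inr (by simp))
      · exact Or.inr ⟨x, hx, rfl⟩
  · rintro ⟨e, (he | he) | ⟨x, hx, rfl⟩, hwe⟩
    · subst he
      simp only [Sym2.mem_iff] at hwe
      tauto
    · exact hw ⟨e, he, hwe⟩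
    · simp only [Sym2.mem_iff] at hwe
      rcases hwe with h | h
      · exact hz2 h.symm
      · subst h; exact hwX hx
  · intro x hx
    exact ⟨s(z, x), Or.inr ⟨x, hx, rfl⟩, by simp⟩

theorem ly_map_indep_iff (M : GraphMatroidFamily) (σ : Equiv.Perm ℕ) (I : Set (Sym2 ℕ)) :
    M.M.Indep (Sym2.map σ '' I) ↔ M.M.Indep I := by
  refine ⟨fun h => ?_, M.invariant σ I⟩
  have := M.invariant σ⁻¹ _ h
  rw [← Set.image_comp, ← Sym2.map_comp] at this
  have h2 : (⇑σ⁻¹ ∘ ⇑σ) = id := by ext x; simp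
  rwa [h2, Sym2.map_id, Set.image_id] at this

theorem ly_span (M : GraphMatroidFamily) (d : ℕ) (C : Set (Sym2 ℕ)) (hC : M.IsCircuit C)
    (hCd : minDeg C = d + 1) (V : Finset ℕ) (hV : (eSupp C).ncard ≤ V.card) (v : ℕ) (hv : v ∉ V)
    (D : Finset ℕ) (hD : D ⊆ V) (hDd : d ≤ D.card) :
    clique (insert v (V : Set ℕ)) ⊆ M.M.closure (clique (V : Set ℕ) ∪ lyStar v D) := by
  classical
  have hg : clique (V : Set ℕ) ∪ lyStar v D ⊆ M.M.E := by
    refine Set.union_subset (ly_clique_ground M _) ?_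
    rw [M.ground_eq]
    rintro e ⟨x, hx, rfl⟩
    simp only [Set.mem_ofPred_eq, Sym2.mk_isDiag_iff]
    rintro rfl
    exact hv (hD hx)
  have hcl := M.M.subset_closure _ hg
  have hmain : ∀ w ∈ V, s(v, w) ∈ M.M.closure (clique (V : Set ℕ) ∪ lyStar v D) := by
    intro w hw
    by_cases hwD : w ∈ D
    · exact hcl (Or.inr ⟨w, hwD, rfl⟩)
    obtain ⟨D', hD', hD'c⟩ := Finset.exists_subset_card_eq hDd
    have hwD' : w ∉ D' := fun h => hwD (hD' h)
    obtain ⟨⟨hCfin, hCd'⟩, hCni, hCi⟩ := hC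
    have hne : C.Nonempty := by
      rw [Set.nonempty_iff_ne_empty]
      rintro rfl
      exact hCni M.M.empty_indep
    obtain ⟨e0, he0⟩ := hne
    have hsne : (eSupp C).Nonempty := ⟨e0.out.1, e0, he0, Sym2.out_fst_mem e0⟩
    obtain ⟨p, hp, hpd⟩ : minDeg C ∈ {k : ℕ | ∃ v ∈ eSupp C, deg C v = k} :=
      Nat.sInf_mem ⟨_, hsne.some, hsne.some_mem, rfl⟩
    have hSf := ly_eSupp_finite hCfin
    set S := hSf.toFinset with hS
    have hSc : (eSupp C).ncard = S.card := Set.ncard_eq_toFinset_card _ hSf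
    have hpS : p ∈ S := by simpa [hS] using hp
    set A := S.filter (fun q => s(p, q) ∈ C) with hA
    set B := (S \ A).erase p with hB
    have hpA : p ∉ A := by
      intro h
      have := hCd' _ (Finset.mem_filter.1 h).2
      simp at this
    have hAc : A.card = d + 1 := by
      rw [← hCd, ← hpd, deg, ← lyStar_ncard p A]
      congr 1
      ext e
      constructor
      · rintro ⟨q, hq, rfl⟩
        exact ⟨(Finset.mem_filter.1 hq).2, by simp⟩
      · rintro ⟨he, hpe⟩
        obtain ⟨q, rfl⟩ := hpe
        refine ⟨q, ?_, rfl⟩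
        simp only [hA, Finset.coe_filter, Set.mem_ofPred_eq]
        exact ⟨hSf.mem_toFinset.2 ⟨_, he, by simp⟩, he⟩
    have hBc : B.card + 1 + A.card = S.card := by
      rw [hB, Finset.card_erase_add_one (Finset.mem_sdiff.2 ⟨hpS, hpA⟩),
        Finset.card_sdiff_add_card_eq_card (Finset.filter_subset _ _)]
    obtain ⟨σ, hσp, hσA, hσA', hσB⟩ := ly_perm_parts A B (insert w D') V p v
      (Finset.disjoint_left.2 fun x hx hxB =>
        (Finset.mem_sdiff.1 (Finset.mem_of_mem_erase hxB)).2 hx) hpA (by simp [hB])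
      (Finset.insert_subset hw (hD'.trans hD)) hv
      (by rw [Finset.card_insert_of_notMem hwD', hAc, hD'c]) (by omega)
    obtain ⟨q, hqA, hq⟩ := hσA' w (Finset.mem_insert_self _ _)
    have hqC : s(p, q) ∈ C := (Finset.mem_filter.1 hqA).2
    have hind : M.M.Indep (Sym2.map σ '' (C \ {s(p, q)})) := M.invariant σ _ (hCi _ hqC)
    have hins : insert s(v, w) (Sym2.map σ '' (C \ {s(p, q)})) = Sym2.map σ '' C := by
      have : s(v, w) = Sym2.map σ s(p, q) := by simp [hσp, hq]
      rw [this, ← Set.image_insert_eq, Set.insert_sdiff_singleton, Set.insert_eq_of_mem hqC]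
    have hVw : s(v, w) ∈ M.M.E := by
      rw [M.ground_eq]
      simp only [Set.mem_ofPred_eq, Sym2.mk_isDiag_iff]
      rintro rfl; exact hv hw
    have hmem : s(v, w) ∈ M.M.closure (Sym2.map σ '' (C \ {s(p, q)})) := by
      by_contra hnot
      rw [hind.notMem_closure_iff hVw, hins, ly_map_indep_iff] at hnot
      exact hCni hnot.1
    refine M.M.closure_subset_closure ?_ hmem
    have hSV : ∀ x ∈ eSupp C, x ≠ p → σ x ∈ V := by
      intro x hx hxp
      have hxS : x ∈ S := by simpa [hS] using hx
      by_cases hxA : x ∈ A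
      · exact (Finset.insert_subset hw (hD'.trans hD)) (hσA x hxA)
      · exact hσB x (by simp [hB, hxp, hxS, hxA])
    rintro _ ⟨e, ⟨he, heq⟩, rfl⟩
    by_cases hpe : p ∈ e
    · obtain ⟨q', rfl⟩ := hpe
      right
      have hq'A : q' ∈ A := by
        simp only [hA, Finset.mem_filter]
        exact ⟨hSf.mem_toFinset.2 ⟨_, he, by simp⟩, he⟩
      refine ⟨σ q', ?_, by simp [hσp]⟩
      rcases Finset.mem_insert.1 (hσA q' hq'A) with h | h
      · exfalso
        apply heq
        have : q' = q := σ.injective (h.trans hq.symm)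
        rw [this]; rfl
      · exact hD' h
    · left
      induction e using Sym2.ind with
      | _ a b =>
        simp only [Sym2.mem_iff, not_or] at hpe
        rw [Sym2.map_mk, ly_mem_clique]
        refine ⟨?_, hSV a ⟨_, he, by simp⟩ (Ne.symm hpe.1), hSV b ⟨_, he, by simp⟩ (Ne.symm hpe.2)⟩
        intro h
        have := hCd' _ he
        exact this (by simpa using h)
  intro e he
  induction e using Sym2.ind with
  | _ a b =>
    rw [ly_mem_clique] at he
    obtain ⟨hab, ha, hb⟩ := he
    rcases ha with rfl | ha
    · rcases hb with rfl | hb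
      · exact absurd rfl hab
      · exact hmain b hb
    · rcases hb with rfl | hb
      · rw [Sym2.eq_swap]; exact hmain a ha
      · exact hcl (Or.inl (ly_mem_clique.2 ⟨hab, ha, hb⟩))

theorem ly_rank_bound (M : GraphMatroidFamily) (d : ℕ) (C : Set (Sym2 ℕ)) (hC : M.IsCircuit C)
    (hCd : minDeg C = d + 1) (t : ℕ) (ht : (eSupp C).ncard + d ≤ t) (V : Finset ℕ) :
    M.M.eRk (clique (V : Set ℕ)) ≤ ((d * V.card + t * t : ℕ) : ℕ∞) := by
  classical
  have hsmall : ∀ V : Finset ℕ, V.card ≤ t →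
      M.M.eRk (clique (V : Set ℕ)) ≤ ((d * V.card + t * t : ℕ) : ℕ∞) := by
    intro V hV
    refine (M.M.eRk_le_encard _).trans ((ly_clique_finite V).2.trans ?_)
    have : V.card * V.card ≤ d * V.card + t * t :=
      (Nat.mul_le_mul hV hV).trans (Nat.le_add_left _ _)
    exact_mod_cast this
  induction V using Finset.induction_on with
  | empty => exact hsmall _ (by simp)
  | insert v V hv ih =>
    by_cases hle : (insert v V).card ≤ t
    · exact hsmall _ hle
    rw [Finset.card_insert_of_notMem hv] at hle ⊢
    obtain ⟨D, hD, hDc⟩ := Finset.exists_subset_card_eq (s := V) (n := d) (by omega)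
    have hsp := ly_span M d C hC hCd V (by omega) v hv D hD hDc.ge
    rw [Finset.coe_insert]
    calc M.M.eRk (clique (insert v (V : Set ℕ)))
        ≤ M.M.eRk (M.M.closure (clique (V : Set ℕ) ∪ lyStar v D)) := M.M.eRk_mono hsp
      _ = M.M.eRk (clique (V : Set ℕ) ∪ lyStar v D) := M.M.eRk_closure_eq _
      _ ≤ M.M.eRk (clique (V : Set ℕ)) + (lyStar v D).encard := M.M.eRk_union_le_eRk_add_encard _ _
      _ ≤ ((d * V.card + t * t : ℕ) : ℕ∞) + (d : ℕ) := by
        rw [lyStar_encard, hDc]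
        exact add_le_add_left ih _
      _ = ((d * (V.card + 1) + t * t : ℕ) : ℕ∞) := by
        rw [← Nat.cast_add]
        congr 1
        ring

theorem ly_step_card {I : Set (Sym2 ℕ)} (hIf : I.Finite) {U : Set ℕ} (hI : I ⊆ clique U) {a : ℕ}
    (ha : a ∉ U) (D : Finset ℕ) : (I ∪ lyStar a D).ncard = I.ncard + D.card := by
  rw [Set.ncard_union_eq ?_ hIf (lyStar_finite a D), lyStar_ncard]
  rw [Set.disjoint_left]
  rintro e he ⟨x, hx, rfl⟩
  exact ha ((hI he).2 a (by simp))

theorem ly_step_sub {F I : Set (Sym2 ℕ)} {U N : Finset ℕ} (hI : I ⊆ F ∩ clique (U : Set ℕ))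
    {a : ℕ} (ha : a ∉ U) (hN : N ⊆ U) (hNF : ∀ w ∈ N, s(a, w) ∈ F) (D : Finset ℕ) (hD : D ⊆ N) :
    I ∪ lyStar a D ⊆ F ∩ clique ((insert a U : Finset ℕ) : Set ℕ) := by
  rintro e (he | ⟨x, hx, rfl⟩)
  · refine ⟨(hI he).1, (hI he).2.1, fun v hv => ?_⟩
    rw [Finset.coe_insert]
    exact Set.mem_insert_of_mem _ ((hI he).2.2 v hv)
  · have hxU := hN (hD hx)
    refine ⟨hNF x (hD hx), ?_⟩
    dsimp only
    rw [ly_mem_clique]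
    refine ⟨?_, by simp, by simp [hxU]⟩
    rintro rfl
    exact ha hxU

theorem ly_step (M : GraphMatroidFamily) (d : ℕ) (hd0 : 0 < d) (hd : M.IsDimensionality d)
    (hext : ∀ G G' : Set (Sym2 ℕ), IsGraph G → M.Indep G → EdgeSplit d G G' → M.Indep G')
    (V : Finset ℕ) (F : Set (Sym2 ℕ))
    (hcl : ∀ e ∈ clique (V : Set ℕ), e ∈ M.M.closure F → e ∈ F)
    (U N : Finset ℕ) (hU : U ⊆ V) (a : ℕ) (ha : a ∉ U) (hN : N ⊆ U)
    (hNF : ∀ w ∈ N, s(a, w) ∈ F) (I : Set (Sym2 ℕ)) (hI : I ⊆ F ∩ clique (U : Set ℕ))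
    (hIi : M.M.Indep I) :
    ∃ J, J ⊆ F ∩ clique ((insert a U : Finset ℕ) : Set ℕ) ∧ M.M.Indep J ∧ I.ncard ≤ J.ncard ∧
      (d < N.card → I.ncard + d ≤ J.ncard ∧
        ((∃ x ∈ N, ∃ y ∈ N, x ≠ y ∧ s(x, y) ∉ F) → I.ncard + d + 1 ≤ J.ncard)) := by
  classical
  have hIf : I.Finite := (ly_clique_finite U).1.subset fun e he => (hI he).2
  have haI : a ∉ eSupp I := by
    rintro ⟨e, he, hae⟩
    exact ha ((hI he).2.2 a hae)
  by_cases hlt : d < N.card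
  swap
  · refine ⟨I ∪ lyStar a ∅, ly_step_sub hI ha hN hNF ∅ (by simp), ?_, ?_, fun h => absurd h hlt⟩
    · simpa [lyStar] using hIi
    · simp [lyStar]
  by_cases hex : ∃ x ∈ N, ∃ y ∈ N, x ≠ y ∧ s(x, y) ∉ F
  · obtain ⟨x, hx, y, hy, hxy, hxyF⟩ := hex
    obtain ⟨X, hX, hXc⟩ := Finset.exists_subset_card_eq (s := (N.erase x).erase y) (n := d - 1) (by
      rw [Finset.card_erase_of_mem (Finset.mem_erase.2 ⟨hxy.symm, hy⟩),
        Finset.card_erase_of_mem hx]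
      omega)
    have hxX : x ∉ X := fun h => by simpa using hX h
    have hyX : y ∉ X := fun h => by simpa using hX h
    have hXN : X ⊆ N := hX.trans ((Finset.erase_subset _ _).trans (Finset.erase_subset _ _))
    have haN : a ∉ N := fun h => ha (hN h)
    have hxyV : s(x, y) ∈ clique (V : Set ℕ) := ly_mem_clique.2 ⟨hxy, hU (hN hx), hU (hN hy)⟩
    have hni : s(x, y) ∉ M.M.closure I := fun h =>
      hxyF (hcl _ hxyV (M.M.closure_subset_closure (fun e he => (hI he).1) h))
    have hins : M.M.Indep (insert s(x, y) I) := by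
      rw [hIi.notMem_closure_iff (ly_clique_ground M _ hxyV)] at hni
      exact hni.1
    have hJ := ly_one_ext M d hd0 hd hext I hIf x y a (fun h => hxyF (hI h).1) hins haI
      (fun h => haN (h ▸ hx)) (fun h => haN (h ▸ hy)) X hxX hyX (fun h => haN (hXN h)) hXc
    have hc : (insert x (insert y X)).card = d + 1 := by
      rw [Finset.card_insert_of_notMem (by simp [hxy, hxX]), Finset.card_insert_of_notMem hyX]
      omega
    have hcard := ly_step_card hIf (fun e he => (hI he).2) (by simpa using ha)
      (insert x (insert y X))
    refine ⟨_, ly_step_sub hI ha hN hNF (insert x (insert y X)) ?_, hJ, by omega,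
      fun _ => ⟨by omega, fun _ => by omega⟩⟩
    exact Finset.insert_subset hx (Finset.insert_subset hy hXN)
  · obtain ⟨X, hX, hXc⟩ := Finset.exists_subset_card_eq hlt.le
    have hcard := ly_step_card hIf (fun e he => (hI he).2) (by simpa using ha) X
    exact ⟨_, ly_step_sub hI ha hN hNF X hX,
      ly_zero_ext M d hd I hIi a haI X (fun h => ha (hN (hX h))) hXc.le, by omega,
      fun _ => ⟨by omega, fun h => absurd h hex⟩⟩

open Classical Finset in
theorem ly_order (M : GraphMatroidFamily) (d : ℕ) (hd0 : 0 < d) (hd : M.IsDimensionality d)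
    (hext : ∀ G G' : Set (Sym2 ℕ), IsGraph G → M.Indep G → EdgeSplit d G G' → M.Indep G')
    (V : Finset ℕ) (F : Set (Sym2 ℕ))
    (hcl : ∀ e ∈ clique (V : Set ℕ), e ∈ M.M.closure F → e ∈ F) (x y : ℕ → ℕ)
    (hxy : ∀ v ∈ V, x v ∈ V ∧ y v ∈ V ∧ x v ≠ y v ∧ s(v, x v) ∈ F ∧ s(v, y v) ∈ F ∧
      s(x v, y v) ∉ F) (σ : Equiv.Perm ℕ) (m : ℕ) :
    ∃ I, I ⊆ F ∩ clique ((V.filter (fun v => σ v < m) : Finset ℕ) : Set ℕ) ∧ M.M.Indep I ∧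
      d * #(V.filter (fun v => σ v < m)) +
        #((V.filter (fun v => σ v < m)).filter (fun v => σ (x v) < σ v ∧ σ (y v) < σ v)) ≤
      I.ncard + (d + 1) * #((V.filter (fun v => σ v < m)).filter
        (fun v => #{w ∈ {w ∈ V | s(v, w) ∈ F} | σ w < σ v} ≤ d)) := by
  induction m with
  | zero => exact ⟨∅, by simp, M.M.empty_indep, by simp⟩
  | succ m ih =>
    obtain ⟨I, hI, hIi, hc⟩ := ih
    by_cases ha : σ.symm m ∈ V
    swap
    · have : V.filter (fun v => σ v < m + 1) = V.filter (fun v => σ v < m) := by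
        apply Finset.filter_congr
        intro v hv
        have : σ v ≠ m := by
          rintro rfl
          simp [hv] at ha
        omega
      rw [this]
      exact ⟨I, hI, hIi, hc⟩
    set a := σ.symm m with hadef
    have hσa : σ a = m := by simp [hadef]
    have hUa : V.filter (fun v => σ v < m + 1) = insert a (V.filter (fun v => σ v < m)) := by
      ext v
      simp only [Finset.mem_filter, Finset.mem_insert]
      constructor
      · rintro ⟨hv, hlt⟩
        by_cases h : σ v = m
        · left; rw [hadef, ← h]; simp
        · right; exact ⟨hv, by omega⟩
      · rintro (rfl | ⟨hv, hlt⟩)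
        · exact ⟨ha, by omega⟩
        · exact ⟨hv, by omega⟩
    have haU : a ∉ V.filter (fun v => σ v < m) := by simp [hσa]
    obtain ⟨J, hJ, hJi, hJ1, hJ2⟩ := ly_step M d hd0 hd hext V F hcl (V.filter (fun v => σ v < m))
      {w ∈ {w ∈ V | s(a, w) ∈ F} | σ w < σ a} (Finset.filter_subset _ _) a haU
      (by
        intro w hw
        simp only [Finset.mem_filter, hσa] at hw ⊢
        exact ⟨hw.1.1, hw.2⟩)
      (by
        intro w hw
        simp only [Finset.mem_filter] at hw
        exact hw.1.2) I hI hIi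
    rw [hUa]
    refine ⟨J, hJ, hJi, ?_⟩
    obtain ⟨h1, h2, h3, h4, h5, h6⟩ := hxy a ha
    rw [Finset.filter_insert, Finset.filter_insert, Finset.card_insert_of_notMem haU]
    by_cases hbad : #{w ∈ {w ∈ V | s(a, w) ∈ F} | σ w < σ a} ≤ d
    · rw [if_pos hbad, Finset.card_insert_of_notMem (by simp [hσa])]
      have hg := Finset.card_insert_le a (filter (fun v => σ (x v) < σ v ∧ σ (y v) < σ v)
        (filter (fun v => σ v < m) V))
      split_ifs <;> simp only [mul_add] <;> omega
    · rw [if_neg hbad]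
      obtain ⟨h7, h8⟩ := hJ2 (by omega)
      by_cases hgood : σ (x a) < σ a ∧ σ (y a) < σ a
      · rw [if_pos hgood, Finset.card_insert_of_notMem (by simp [hσa])]
        have := h8 ⟨x a, by simp [h1, h4, hgood.1], y a, by simp [h2, h5, hgood.2], h3, h6⟩
        simp only [mul_add] at *
        omega
      · rw [if_neg hgood]
        simp only [mul_add] at *
        omega

open Classical Finset in
theorem ly_count (M : GraphMatroidFamily) (d : ℕ) (hd0 : 0 < d) (hd : M.IsDimensionality d)
    (hext : ∀ G G' : Set (Sym2 ℕ), IsGraph G → M.Indep G → EdgeSplit d G G' → M.Indep G')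
    (V : Finset ℕ) (F : Set (Sym2 ℕ)) (hFV : F ⊆ clique (V : Set ℕ))
    (hcl : ∀ e ∈ clique (V : Set ℕ), e ∈ M.M.closure F → e ∈ F) (x y : ℕ → ℕ)
    (hxy : ∀ v ∈ V, x v ∈ V ∧ y v ∈ V ∧ x v ≠ y v ∧ s(v, x v) ∈ F ∧ s(v, y v) ∈ F ∧
      s(x v, y v) ∉ F) (c T : ℕ) (hc : 6 * (d + 1) * (d + 1) ≤ c)
    (hdeg : ∀ v ∈ V, c ≤ #{w ∈ V | s(v, w) ∈ F})
    (hT : M.M.eRk (clique (V : Set ℕ)) ≤ ((d * #V + T : ℕ) : ℕ∞)) : #V ≤ 6 * T := by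
  obtain ⟨S, hSne, hS⟩ := ly_exists_perms V
  have hirr : ∀ v, s(v, v) ∉ F := fun v h => (hFV h).1 (by simp)
  have hσ : ∀ σ ∈ S, #(V.filter (fun v => σ (x v) < σ v ∧ σ (y v) < σ v)) ≤ T +
      (d + 1) * #(V.filter (fun v => #{w ∈ {w ∈ V | s(v, w) ∈ F} | σ w < σ v} ≤ d)) := by
    intro σ _
    obtain ⟨I, hI, hIi, h⟩ := ly_order M d hd0 hd hext V F hcl x y hxy σ (V.sup σ + 1)
    have hV : V.filter (fun v => σ v < V.sup σ + 1) = V :=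
      Finset.filter_true_of_mem fun v hv => Nat.lt_succ_of_le (Finset.le_sup (f := σ) hv)
    rw [hV] at h hI
    have hIf : I.Finite := (ly_clique_finite V).1.subset fun e he => (hI he).2
    have h2 : I.encard ≤ _ := (hIi.encard_le_eRk_of_subset fun e he => (hI he).2).trans hT
    rw [← hIf.cast_ncard_eq] at h2
    have h3 : I.ncard ≤ d * #V + T := by exact_mod_cast h2
    omega
  have hgood : #V * #S ≤ 3 * ∑ σ ∈ S, #(V.filter (fun v => σ (x v) < σ v ∧ σ (y v) < σ v)) := by
    have : ∑ σ ∈ S, #(V.filter (fun v => σ (x v) < σ v ∧ σ (y v) < σ v)) =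
        ∑ v ∈ V, #(S.filter (fun σ => σ (x v) < σ v ∧ σ (y v) < σ v)) := by
      simp only [Finset.card_filter]
      exact Finset.sum_comm
    rw [this, Finset.mul_sum, ← smul_eq_mul]
    refine Finset.card_nsmul_le_sum _ _ _ fun v hv => ?_
    obtain ⟨h1, h2, h3, h4, h5, h6⟩ := hxy v hv
    refine ly_count_good S V hS v (x v) (y v) hv h1 h2 ?_ ?_
    · intro h; rw [← h] at h4; exact hirr v h4
    · intro h; rw [← h] at h5; exact hirr v h5
  have hbad : c * ∑ σ ∈ S, #(V.filter (fun v => #{w ∈ {w ∈ V | s(v, w) ∈ F} | σ w < σ v} ≤ d)) ≤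
      #V * ((d + 1) * #S) := by
    have : ∑ σ ∈ S, #(V.filter (fun v => #{w ∈ {w ∈ V | s(v, w) ∈ F} | σ w < σ v} ≤ d)) =
        ∑ v ∈ V, #(S.filter (fun σ => #{w ∈ {w ∈ V | s(v, w) ∈ F} | σ w < σ v} ≤ d)) := by
      simp only [Finset.card_filter]
      exact Finset.sum_comm
    rw [this, Finset.mul_sum, ← smul_eq_mul (#V)]
    refine Finset.sum_le_card_nsmul _ _ _ fun v hv => ?_
    have h := ly_count_bad S V (insert v {w ∈ V | s(v, w) ∈ F})
      (Finset.insert_subset hv (Finset.filter_subset _ _)) hS v (Finset.mem_insert_self _ _) d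
    refine le_trans (Nat.mul_le_mul ?_ (le_of_eq ?_)) h
    · exact (hdeg v hv).trans (Finset.card_le_card (Finset.subset_insert _ _))
    · congr 1
      apply Finset.filter_congr
      intro σ _
      rw [Finset.filter_insert, if_neg (lt_irrefl _)]
  have hsum := Finset.sum_le_sum hσ
  rw [Finset.sum_add_distrib, ← Finset.mul_sum, Finset.sum_const, smul_eq_mul] at hsum
  set A := ∑ σ ∈ S, #(V.filter (fun v => σ (x v) < σ v ∧ σ (y v) < σ v))
  set B := ∑ σ ∈ S, #(V.filter (fun v => #{w ∈ {w ∈ V | s(v, w) ∈ F} | σ w < σ v} ≤ d))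
  have hs : 0 < #S := Finset.card_pos.2 hSne
  have hcpos : 0 < c := by nlinarith
  have e1 : c * (#V * #S) ≤ 3 * (c * #S * T) + 3 * (d + 1) * (#V * ((d + 1) * #S)) := by
    calc c * (#V * #S) ≤ c * (3 * (#S * T + (d + 1) * B)) :=
          Nat.mul_le_mul_left _ (hgood.trans (Nat.mul_le_mul_left _ hsum))
      _ = 3 * (c * #S * T) + 3 * (d + 1) * (c * B) := by ring
      _ ≤ _ := Nat.add_le_add_left (Nat.mul_le_mul_left _ hbad) _
  have e2 : 6 * (d + 1) * (d + 1) * (#V * #S) ≤ c * (#V * #S) := Nat.mul_le_mul_right _ hc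
  have e3 : (c * #S) * #V ≤ (c * #S) * (6 * T) := by nlinarith
  exact Nat.le_of_mul_le_mul_left e3 (Nat.mul_pos hcpos hs)

/-- Every vertex cut of the graph `(V, E)` has at least `c` vertices. -/
def LySep (c : ℕ) (V : Finset ℕ) (E : Set (Sym2 ℕ)) : Prop :=
  ∀ A B : Finset ℕ, A ⊆ V → B ⊆ V → Disjoint A B → A.Nonempty → B.Nonempty →
    (∀ a ∈ A, ∀ b ∈ B, s(a, b) ∉ E) → A.card + B.card + c ≤ V.card

theorem LySep.mono {c : ℕ} {V : Finset ℕ} {E F : Set (Sym2 ℕ)} (h : LySep c V E) (hEF : E ⊆ F) :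
    LySep c V F := fun A B hA hB hd ha hb hn =>
  h A B hA hB hd ha hb fun a haA b hbB hab => hn a haA b hbB (hEF hab)

open Classical in
theorem LySep.degree {c : ℕ} {V : Finset ℕ} {E : Set (Sym2 ℕ)} (h : LySep c V E)
    (hE : E ⊆ clique (V : Set ℕ)) (hc : c + 1 ≤ V.card) (v : ℕ) (hv : v ∈ V) :
    c ≤ (V.filter (fun w => s(v, w) ∈ E)).card := by
  set N := V.filter (fun w => s(v, w) ∈ E) with hN
  have hvN : v ∉ N := fun hm => (hE (Finset.mem_filter.1 hm).2).1 (by simp)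
  have hsub : insert v N ⊆ V := Finset.insert_subset hv (Finset.filter_subset _ _)
  have hcard := Finset.card_sdiff_add_card_eq_card hsub
  rw [Finset.card_insert_of_notMem hvN] at hcard
  rcases (V \ insert v N).eq_empty_or_nonempty with he | hne
  · rw [he, Finset.card_empty] at hcard
    omega
  · have := h {v} (V \ insert v N) (by simpa using hv) Finset.sdiff_subset (by simp) (by simp) hne
      (by
        intro a ha b hb hab
        rw [Finset.mem_singleton] at ha
        subst ha
        rw [Finset.mem_sdiff] at hb
        exact hb.2 (Finset.mem_insert_of_mem (Finset.mem_filter.2 ⟨hb.1, hab⟩)))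
    rw [Finset.card_singleton] at this
    omega

theorem LySep.erase {c : ℕ} {V : Finset ℕ} {F : Set (Sym2 ℕ)} (h : LySep c V F) (v : ℕ)
    (hv : v ∈ V)
    (hsimp : ∀ x ∈ V, ∀ y ∈ V, x ≠ y → s(v, x) ∈ F → s(v, y) ∈ F → s(x, y) ∈ F) :
    LySep c (V.erase v) (F ∩ clique ((V.erase v : Finset ℕ) : Set ℕ)) := by
  classical
  intro A B hA hB hAB hAn hBn hno
  have hvA : v ∉ A := fun h => by simpa using hA h
  have hvB : v ∉ B := fun h => by simpa using hB h
  have hAV := hA.trans (Finset.erase_subset v V)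
  have hBV := hB.trans (Finset.erase_subset v V)
  have hno' : ∀ a ∈ A, ∀ b ∈ B, s(a, b) ∉ F := by
    intro a ha b hb hab
    refine hno a ha b hb ⟨hab, ly_mem_clique.2 ⟨?_, hA ha, hB hb⟩⟩
    rintro rfl
    exact Finset.disjoint_left.1 hAB ha hb
  have hcard := Finset.card_erase_add_one hv
  by_cases hNA : ∃ a ∈ A, s(v, a) ∈ F
  · obtain ⟨a, ha, haF⟩ := hNA
    have := h (insert v A) B (Finset.insert_subset hv hAV) hBV
      (by rw [Finset.disjoint_insert_left]; exact ⟨hvB, hAB⟩) (by simp) hBn (by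
        intro a' ha' b hb hab
        rcases Finset.mem_insert.1 ha' with rfl | ha'
        · refine hno' a ha b hb (hsimp a (hAV ha) b (hBV hb) ?_ haF hab)
          rintro rfl
          exact Finset.disjoint_left.1 hAB ha hb
        · exact hno' a' ha' b hb hab)
    rw [Finset.card_insert_of_notMem hvA] at this
    omega
  · have := h A (insert v B) hAV (Finset.insert_subset hv hBV)
      (by rw [Finset.disjoint_insert_right]; exact ⟨hvA, hAB⟩) hAn (by simp) (by
        intro a ha b hb hab
        rcases Finset.mem_insert.1 hb with rfl | hb
        · exact hNA ⟨a, ha, by rwa [Sym2.eq_swap]⟩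
        · exact hno' a ha b hb hab)
    rw [Finset.card_insert_of_notMem hvB] at this
    omega

theorem ly_main (M : GraphMatroidFamily) (d : ℕ) (hd0 : 0 < d) (hd : M.IsDimensionality d)
    (hext : ∀ G G' : Set (Sym2 ℕ), IsGraph G → M.Indep G → EdgeSplit d G G' → M.Indep G')
    (C : Set (Sym2 ℕ)) (hC : M.IsCircuit C) (hCd : minDeg C = d + 1) (t c : ℕ)
    (ht : (eSupp C).ncard + d ≤ t) (hc : 6 * (d + 1) * (d + 1) + 6 * (t * t) + t ≤ c) (n : ℕ) :
    ∀ V : Finset ℕ, V.card = n → c + 1 ≤ V.card → ∀ E : Set (Sym2 ℕ), E ⊆ clique (V : Set ℕ) →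
      LySep c V E → clique (V : Set ℕ) ⊆ M.M.closure E := by
  classical
  induction n with
  | zero => intro V hV hcV; omega
  | succ n ih =>
    intro V hVn hcV E hE hsepE
    set F := M.M.closure E ∩ clique (V : Set ℕ) with hF
    have hEF : E ⊆ F := fun e he => ⟨M.M.subset_closure E (hE.trans (ly_clique_ground M _)) he, hE he⟩
    have hFV : F ⊆ clique (V : Set ℕ) := Set.inter_subset_right
    have hFE : F ⊆ M.M.closure E := Set.inter_subset_left
    have hclF : M.M.closure F ⊆ M.M.closure E := M.M.closure_subset_closure_of_subset_closure hFE
    have hsep := hsepE.mono hEF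
    have hdeg := hsep.degree hFV hcV
    by_cases hsim : ∃ v ∈ V, ∀ x ∈ V, ∀ y ∈ V, x ≠ y → s(v, x) ∈ F → s(v, y) ∈ F → s(x, y) ∈ F
    · obtain ⟨v, hv, hsimp⟩ := hsim
      have hcard := Finset.card_erase_add_one hv
      set N := V.filter (fun w => s(v, w) ∈ F) with hN
      have hvN : v ∉ N := fun hm => (hFV (Finset.mem_filter.1 hm).2).1 (by simp)
      have hNV : N ⊆ V.erase v := fun w hw =>
        Finset.mem_erase.2 ⟨fun h => hvN (h ▸ hw), (Finset.mem_filter.1 hw).1⟩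
      have hNc : c ≤ N.card := by convert hdeg v hv
      have hclE : clique ((V.erase v : Finset ℕ) : Set ℕ) ⊆ M.M.closure E := by
        by_cases hbig : c + 1 ≤ (V.erase v).card
        · refine (ih (V.erase v) (by omega) hbig _ Set.inter_subset_right
            (hsep.erase v hv hsimp)).trans ?_
          exact (M.M.closure_subset_closure Set.inter_subset_left).trans hclF
        · have hNeq : N = V.erase v := Finset.eq_of_subset_of_card_le hNV (by omega)
          intro e he
          induction e using Sym2.ind with
          | _ a b =>
            obtain ⟨hab, ha, hb⟩ := ly_mem_clique.1 he
            rw [Finset.mem_coe, ← hNeq] at ha hb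
            have ha' := Finset.mem_filter.1 ha
            have hb' := Finset.mem_filter.1 hb
            exact hFE (hsimp a ha'.1 b hb'.1 hab ha'.2 hb'.2)
      have hsp := ly_span M d C hC hCd (V.erase v) (by omega) v (by simp) N hNV (by omega)
      rw [← Finset.coe_insert, Finset.insert_erase hv] at hsp
      refine hsp.trans (M.M.closure_subset_closure_of_subset_closure (Set.union_subset hclE ?_))
      rintro _ ⟨w, hw, rfl⟩
      exact hFE (Finset.mem_filter.1 hw).2
    · exfalso
      push Not at hsim
      choose! x hx y hy hxy h1 h2 h3 using hsim
      have := ly_count M d hd0 hd hext V F hFV (fun e he h => ⟨hclF h, he⟩) x y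
        (fun v hv => ⟨hx v hv, hy v hv, hxy v hv, h1 v hv, h2 v hv, h3 v hv⟩) c (t * t) (by omega)
        hdeg (ly_rank_bound M d C hC hCd t ht V)
      omega

theorem ly_sep_of_connected (c : ℕ) (E : Set (Sym2 ℕ)) (hE : IsGraph E) (h : KConnected c E)
    (V : Finset ℕ) (hV : (V : Set ℕ) = eSupp E) : LySep c V E := by
  classical
  intro A B hA hB hAB hAn hBn hno
  have hsub : A ∪ B ⊆ V := Finset.union_subset hA hB
  have hcard := Finset.card_sdiff_add_card_eq_card hsub
  rw [Finset.card_union_of_disjoint hAB] at hcard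
  by_contra hlt
  have hconn := h.2 (V \ (A ∪ B)) (by omega)
  obtain ⟨a, ha⟩ := hAn
  obtain ⟨b, hb⟩ := hBn
  have hmem : ∀ z, z ∈ A ∨ z ∈ B → z ∈ eSupp E \ ((V \ (A ∪ B) : Finset ℕ) : Set ℕ) := by
    intro z hz
    refine ⟨?_, ?_⟩
    · rw [← hV]; exact hsub (Finset.mem_union.2 hz)
    · simp only [Finset.coe_sdiff, Set.mem_sdiff, Finset.mem_coe, Finset.mem_union, not_and, not_not]
      exact fun _ => hz
  obtain ⟨w⟩ := hconn.preconnected ⟨a, hmem a (Or.inl ha)⟩ ⟨b, hmem b (Or.inr hb)⟩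
  have key : ∀ (p q : ↥(eSupp E \ ((V \ (A ∪ B) : Finset ℕ) : Set ℕ)))
      (_ : ((SimpleGraph.fromEdgeSet E).induce _).Walk p q), (p : ℕ) ∈ A → (q : ℕ) ∈ A := by
    intro p q w
    induction w with
    | nil => exact id
    | @cons u v' w' hadj _ ih =>
      intro hu
      apply ih
      have hE' : s((u : ℕ), (v' : ℕ)) ∈ E := by
        have := hadj
        simp only [SimpleGraph.comap_adj, SimpleGraph.fromEdgeSet_adj,
          Function.Embedding.subtype_apply] at this
        exact this.1
      have hv' := v'.2
      have hv1 : (v' : ℕ) ∈ V := hV.ge hv'.1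
      have hv2 : (v' : ℕ) ∈ A ∪ B := by
        by_contra hn
        exact hv'.2 (by simpa using ⟨hv1, by simpa using hn⟩)
      rcases Finset.mem_union.1 hv2 with h | h
      · exact h
      · exact absurd hE' (hno _ hu _ h)
  exact Finset.disjoint_left.1 hAB (key _ _ w ha) hb

theorem ly_mrk_eq (M₀ : Matroid (Sym2 ℕ)) (X : Set (Sym2 ℕ)) (hX : X.Finite) :
    (mrk M₀ X : ℕ∞) = M₀.eRk X := by
  have hbdd : BddAbove {n : ℕ | ∃ I ⊆ X, M₀.Indep I ∧ I.ncard = n} := by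
    refine ⟨X.ncard, ?_⟩
    rintro n ⟨I, hI, -, rfl⟩
    exact Set.ncard_le_ncard hI hX
  apply le_antisymm
  · obtain ⟨I, hI, hIi, h⟩ := Nat.sSup_mem (s := {n : ℕ | ∃ I ⊆ X, M₀.Indep I ∧ I.ncard = n})
      ⟨0, ∅, by simp, M₀.empty_indep, by simp⟩ hbdd
    rw [mrk, ← h, (hX.subset hI).cast_ncard_eq]
    exact hIi.encard_le_eRk_of_subset hI
  · rw [Matroid.eRk_le_iff]
    intro I hI hIi
    rw [← (hX.subset hI).cast_ncard_eq]
    exact_mod_cast le_csSup hbdd ⟨I, hI, hIi, rfl⟩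

/-- Every `1`-extendable graph matroid family has the
Lovász–Yemini property. -/
theorem lovaszYemini_of_oneExtendable (M : GraphMatroidFamily)
    (h : M.OneExtendable) : M.LovaszYemini := by
  obtain ⟨d, hd0, hd, hext⟩ := h
  obtain ⟨C, hC, hCd⟩ := hd.1
  set t := (eSupp C).ncard + d with ht
  set c := 6 * (d + 1) * (d + 1) + 6 * (t * t) + t with hc
  refine ⟨c, fun E hE hconn => ?_⟩
  have hfin := ly_eSupp_finite hE.1
  have hV : ((hfin.toFinset : Finset ℕ) : Set ℕ) = eSupp E := hfin.coe_toFinset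
  have hVc : (eSupp E).ncard = hfin.toFinset.card := Set.ncard_eq_toFinset_card _ hfin
  have hEV : E ⊆ clique (hfin.toFinset : Set ℕ) := by
    intro e he
    refine ⟨hE.2 e he, fun v hv => ?_⟩
    rw [hV]
    exact ⟨e, he, hv⟩
  have hmain := ly_main M d hd0 hd hext C hC hCd t c le_rfl le_rfl _ hfin.toFinset rfl
    (by rw [← hVc]; exact hconn.1) E hEV (ly_sep_of_connected c E hE hconn _ hV)
  have hcf := (ly_clique_finite hfin.toFinset).1
  rw [hV] at hmain hEV hcf
  have hrk : M.M.eRk E = M.M.eRk (clique (eSupp E)) := by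
    apply le_antisymm (M.M.eRk_mono hEV)
    rw [← M.M.eRk_closure_eq E]
    exact M.M.eRk_mono hmain
  rw [← ly_mrk_eq _ _ hE.1, ← ly_mrk_eq _ _ hcf] at hrk
  exact_mod_cast hrk
end

section
/- If M is an unbounded, nontrivial graph matroid family that is a family of 1-dimensional abstract rigidity matroids, then the M-circuits are precisely the cycle graphs C_n for n ≥ 3; consequently, M is the family of graphic matroids (a graph is M-independent if and only if it is a forest). -/
namespace OneDimProof

open Set

variable (M : GraphMatroidFamily)

lemma mk_mem_ground {a b : ℕ} (h : a ≠ b) : s(a, b) ∈ M.M.E := by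
  rw [M.ground_eq]; simpa using h

lemma graph_sub {E : Set (Sym2 ℕ)} (h : IsGraph E) : E ⊆ M.M.E := by
  rw [M.ground_eq]; exact h.2

lemma comap_eq (σ : Equiv.Perm ℕ) : M.M.comap (Sym2.map σ) = M.M := by
  have hinj : Function.Injective (Sym2.map σ) := Sym2.map.injective σ.injective
  refine Matroid.ext_indep ?_ ?_
  · rw [Matroid.comap_ground_eq, M.ground_eq]
    ext e
    induction e with | h a b => simp
  · intro I _
    rw [Matroid.comap_indep_iff]
    refine ⟨fun h => ?_, fun h => ⟨M.invariant σ I h, hinj.injOn⟩⟩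
    have := M.invariant σ.symm _ h.1
    rw [← Set.image_comp] at this
    have hid : (Sym2.map σ.symm ∘ Sym2.map σ) = id := by
      ext1 e
      induction e with | h a b => simp
    rwa [hid, Set.image_id] at this

lemma closure_perm (σ : Equiv.Perm ℕ) {X : Set (Sym2 ℕ)} {e : Sym2 ℕ}
    (h : e ∈ M.M.closure X) : Sym2.map σ e ∈ M.M.closure (Sym2.map σ '' X) := by
  have := Matroid.comap_closure_eq M.M (Sym2.map σ) X
  rw [comap_eq] at this
  rw [this] at h
  exact h

lemma cl_trans {e f : Sym2 ℕ} {X : Set (Sym2 ℕ)} (h1 : e ∈ M.M.closure {f})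
    (h2 : f ∈ M.M.closure X) : e ∈ M.M.closure X :=
  M.M.closure_subset_closure_of_subset_closure (by simpa using h2) h1

/-- If any two edges are parallel or loops, the rank is bounded. -/
lemma not_all_parallel (hu : M.Unbounded)
    (h : ∀ e f : Sym2 ℕ, ¬ e.IsDiag → ¬ f.IsDiag → e ∈ M.M.closure {f}) : False := by
  obtain ⟨n, hn⟩ := hu 1
  have key : ∀ k ∈ {k : ℕ | ∃ I ⊆ cliqueN n, M.M.Indep I ∧ I.ncard = k}, k ≤ 1 := by
    rintro k ⟨I, hI, hind, rfl⟩
    by_contra hlt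
    push Not at hlt
    obtain ⟨a, b, ha, hb, hab⟩ := (Set.one_lt_ncard_iff
      (Set.finite_of_ncard_pos (by omega))).1 hlt
    have := hind.notMem_closure_sdiff_of_mem ha
    apply this
    exact M.M.closure_subset_closure (by
      rintro x rfl; exact ⟨hb, fun h => hab h.symm⟩) (h a b (hI ha).1 (hI hb).1)
  have : mrk M.M (cliqueN n) ≤ 1 := by
    unfold mrk
    rcases Set.eq_empty_or_nonempty {k : ℕ | ∃ I ⊆ cliqueN n, M.M.Indep I ∧ I.ncard = k} with h0 | h0
    · rw [h0]; simp
    · exact csSup_le h0 key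
  unfold GraphMatroidFamily.rk at hn
  omega

/-- A permutation sending `a,b` to `c,d`. -/
lemma exists_perm2 {a b c d : ℕ} (hab : a ≠ b) (hcd : c ≠ d) :
    ∃ σ : Equiv.Perm ℕ, σ a = c ∧ σ b = d := by
  refine ⟨Equiv.swap (Equiv.swap a c b) d * Equiv.swap a c, ?_, ?_⟩
  · simp only [Equiv.Perm.mul_apply, Equiv.swap_apply_left]
    apply Equiv.swap_apply_of_ne_of_ne _ hcd
    intro h
    apply hab
    have : Equiv.swap a c a = Equiv.swap a c b := by rw [Equiv.swap_apply_left, ← h]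
    exact (Equiv.swap a c).injective this
  · simp

lemma exists_perm3 {a b x c d y : ℕ} (hab : a ≠ b) (hax : a ≠ x) (hbx : b ≠ x)
    (hcd : c ≠ d) (hcy : c ≠ y) (hdy : d ≠ y) :
    ∃ σ : Equiv.Perm ℕ, σ a = c ∧ σ b = d ∧ σ x = y := by
  obtain ⟨σ, h1, h2⟩ := exists_perm2 hab hcd
  refine ⟨Equiv.swap (σ x) y * σ, ?_, ?_, ?_⟩
  · simp only [Equiv.Perm.mul_apply, h1]
    apply Equiv.swap_apply_of_ne_of_ne _ hcy
    rw [← h1]; exact fun h => hax (σ.injective h)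
  · simp only [Equiv.Perm.mul_apply, h2]
    apply Equiv.swap_apply_of_ne_of_ne _ hdy
    rw [← h2]; exact fun h => hbx (σ.injective h)
  · simp

lemma no_loop (hu : M.Unbounded) (e : Sym2 ℕ) (he : ¬ e.IsDiag) : e ∉ M.M.closure ∅ := by
  intro h
  apply not_all_parallel M hu
  intro f g hf _
  apply M.M.closure_subset_closure (empty_subset _)
  induction e with | h a b =>
  induction f with | h c d =>
  obtain ⟨σ, h1, h2⟩ := exists_perm2 (a := a) (b := b) (c := c) (d := d) (by simpa using he)
    (by simpa using hf)
  have := closure_perm M σ h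
  simpa [h1, h2] using this

lemma no_parallel_aux (hu : M.Unbounded) {p q r : ℕ} (hpq : p ≠ q) (hpr : p ≠ r) (hqr : q ≠ r) :
    s(p, q) ∉ M.M.closure {s(p, r)} := by
  intro h
  have A : ∀ a b c : ℕ, a ≠ b → a ≠ c → s(a, b) ∈ M.M.closure {s(a, c)} := by
    intro a b c hab hac
    by_cases hbc : b = c
    · subst hbc
      exact M.M.mem_closure_of_mem (by simp) (by simpa using mk_mem_ground M hab)
    obtain ⟨σ, h1, h2, h3⟩ := exists_perm3 hpq hpr hqr hab hac hbc
    have := closure_perm M σ h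
    simpa [h1, h2, h3] using this
  apply not_all_parallel M hu
  intro e f he hf
  induction e with | h a b =>
  induction f with | h c d =>
  have hab : a ≠ b := by simpa using he
  have hcd : c ≠ d := by simpa using hf
  by_cases hac : a = c
  · subst hac; exact A _ _ _ hab hcd
  · have h1 := A a b c hab hac
    have h2 := A c a d (Ne.symm hac) hcd
    rw [Sym2.eq_swap (a := c) (b := a)] at h2
    exact cl_trans M h1 h2

lemma no_parallel (hu : M.Unbounded) {e f : Sym2 ℕ} (he : ¬ e.IsDiag) (h : f ∈ M.M.closure {e}) :
    f = e := by
  have hf : ¬ f.IsDiag := by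
    have := M.M.closure_subset_ground _ h
    rw [M.ground_eq] at this; exact this
  by_contra hne
  have : ∃ c d : ℕ, f = s(c, d) ∧ c ∉ e ∧ c ≠ d := by
    induction e with | h a b =>
    induction f with | h c d =>
    have hab : a ≠ b := by simpa using he
    have hcd : c ≠ d := by simpa using hf
    by_cases hc : c ∈ s(a, b)
    · refine ⟨d, c, Sym2.eq_swap, ?_, hcd.symm⟩
      intro hd
      apply hne
      exact ((Sym2.mem_and_mem_iff hcd).1 ⟨hc, hd⟩).symm
    · exact ⟨c, d, rfl, hc, hcd⟩
  obtain ⟨c, d, rfl, hc, hcd⟩ := this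
  induction e with | h a b =>
  obtain ⟨x, hx⟩ := Infinite.exists_notMem_finset ({a, b, c, d} : Finset ℕ)
  simp only [Finset.mem_insert, Finset.mem_singleton, not_or] at hx
  simp only [Sym2.mem_iff, not_or] at hc
  have h2 := closure_perm M (Equiv.swap c x) h
  have ha : Equiv.swap c x a = a := Equiv.swap_apply_of_ne_of_ne (Ne.symm hc.1) (by tauto)
  have hb : Equiv.swap c x b = b := Equiv.swap_apply_of_ne_of_ne (Ne.symm hc.2) (by tauto)
  have hd : Equiv.swap c x d = d := Equiv.swap_apply_of_ne_of_ne (Ne.symm hcd) (by tauto)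
  simp only [Sym2.map_mk, Set.image_singleton, ha, hb, hd, Equiv.swap_apply_left] at h2
  have h3 : s(a, b) ∈ M.M.closure {s(c, d)} := by
    have := Matroid.mem_closure_insert (M := M.M) (X := ∅) (e := s(c, d)) (f := s(a, b))
      (no_loop M hu _ hf) (by simpa using h)
    simpa using this
  have h4 := cl_trans M h2 h3
  have h5 : s(d, x) ∈ M.M.closure {s(d, c)} := by
    rwa [Sym2.eq_swap (a := d), Sym2.eq_swap (a := d)]
  exact no_parallel_aux M hu (by tauto) hcd.symm (by tauto) h5

lemma graph_in_cliqueN {E : Set (Sym2 ℕ)} (h : IsGraph E) : ∃ n, 1 ≤ n ∧ E ⊆ cliqueN n := by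
  obtain ⟨hf, hd⟩ := h
  have : ∃ n, ∀ e ∈ E, ∀ v ∈ e, v < n := by
    clear hd
    induction E, hf using Set.Finite.induction_on with
    | empty => exact ⟨0, by simp⟩
    | @insert a s _ _ ih =>
      obtain ⟨n, hn⟩ := ih
      induction a with | h a b =>
      refine ⟨n + a + b + 1, ?_⟩
      intro e he v hv
      rcases he with rfl | he
      · simp only [Sym2.mem_iff] at hv; omega
      · have := hn e he v hv; omega
  obtain ⟨n, hn⟩ := this
  refine ⟨n + 1, by omega, fun e he => ⟨hd e he, fun v hv => ?_⟩⟩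
  have := hn e he v hv
  show v < n + 1
  omega

lemma cliqueN_sub (n : ℕ) : cliqueN n ⊆ M.M.E := by
  rw [M.ground_eq]; exact fun e he => he.1

lemma isGraph_union {E F : Set (Sym2 ℕ)} (hE : IsGraph E) (hF : IsGraph F) : IsGraph (E ∪ F) :=
  ⟨hE.1.union hF.1, fun e he => he.elim (hE.2 e) (hF.2 e)⟩

lemma isGraph_single {e : Sym2 ℕ} (he : ¬ e.IsDiag) : IsGraph {e} :=
  ⟨Set.finite_singleton e, by simpa using he⟩

lemma isGraph_sub {E F : Set (Sym2 ℕ)} (hE : IsGraph E) (h : F ⊆ E) : IsGraph F :=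
  ⟨hE.1.subset h, fun e he => hE.2 e (h he)⟩

lemma cl_union (h : M.FamilyOfARM 1) {E F : Set (Sym2 ℕ)} (hE : IsGraph E) (hF : IsGraph F)
    (hd : ∀ v ∈ eSupp E, v ∉ eSupp F) {x : Sym2 ℕ} (hx : x ∈ M.M.closure (E ∪ F)) :
    x ∈ M.M.closure E ∨ x ∈ M.M.closure F := by
  have hxd : ¬ x.IsDiag := by
    have := M.M.closure_subset_ground _ hx
    rw [M.ground_eq] at this; exact this
  obtain ⟨n, hn, hs⟩ := graph_in_cliqueN (isGraph_union (isGraph_union hE hF) (isGraph_single hxd))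
  have hEF : E ∪ F ⊆ cliqueN n := subset_union_left.trans hs
  have hxn : x ∈ cliqueN n := hs (by simp)
  have hE' : E ⊆ cliqueN n := subset_union_left.trans hEF
  have hF' : F ⊆ cliqueN n := subset_union_right.trans hEF
  have h0 : eSupp E ∩ eSupp F = ∅ := by
    ext v; simp only [mem_inter_iff, mem_empty_iff_false, iff_false]
    exact fun hv => hd v hv.1 hv.2
  have := (h n hn).2.1 E F hE' hF' (by rw [h0]; simp)
  rw [Matroid.restrict_closure_eq _ hEF (cliqueN_sub M n),
    Matroid.restrict_closure_eq _ hE' (cliqueN_sub M n),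
    Matroid.restrict_closure_eq _ hF' (cliqueN_sub M n)] at this
  have hmem : x ∈ M.M.closure (E ∪ F) ∩ cliqueN n := ⟨hx, hxn⟩
  rw [this] at hmem
  exact hmem.imp (·.1) (·.1)

lemma eSupp_single (a b : ℕ) : eSupp {s(a, b)} = {a, b} := by
  ext v; simp [eSupp]

lemma clique_pair {a b : ℕ} (hab : a ≠ b) : clique {a, b} = {s(a, b)} := by
  ext e
  induction e with | h c d =>
  simp only [clique, Set.mem_ofPred_eq, Sym2.mem_iff, mem_singleton_iff, Sym2.mk_isDiag_iff,
    mem_insert_iff, Sym2.eq_iff, forall_eq_or_imp, forall_eq]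
  grind

lemma triangle (hu : M.Unbounded) (h : M.FamilyOfARM 1) {a b c : ℕ} (hab : a ≠ b) (hbc : b ≠ c)
    (hac : a ≠ c) : s(a, c) ∈ M.M.closure {s(a, b), s(b, c)} := by
  set n := a + b + c + 1 with hn
  have g1 : ∀ x y : ℕ, x < n → y < n → x ≠ y → s(x, y) ∈ cliqueN n := by
    intro x y hx hy hxy
    refine ⟨by simpa using hxy, ?_⟩
    intro v hv
    simp only [Sym2.mem_iff] at hv
    rcases hv with rfl | rfl <;> assumption
  have cl1 : ∀ x y : ℕ, x < n → y < n → x ≠ y →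
      (M.M.restrict (cliqueN n)).closure {s(x, y)} = clique (eSupp {s(x, y)}) := by
    intro x y hx hy hxy
    rw [Matroid.restrict_closure_eq _ (by simpa using g1 x y hx hy hxy) (cliqueN_sub M n),
      eSupp_single, clique_pair hxy]
    ext e
    constructor
    · rintro ⟨he, -⟩
      exact no_parallel M hu (by simpa using hxy) he
    · rintro rfl
      exact ⟨M.M.mem_closure_of_mem (by simp) (by simpa using mk_mem_ground M hxy),
        g1 x y hx hy hxy⟩
  have k1 := g1 a b (by omega) (by omega) hab
  have k2 := g1 b c (by omega) (by omega) hbc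
  have := (h n (by omega)).2.2 {s(a, b)} {s(b, c)} (Set.singleton_subset_iff.2 k1) (Set.singleton_subset_iff.2 k2) (by
      refine (Set.ncard_pos (by rw [eSupp_single]; exact (Set.toFinite _).inter_of_left _)).2 ?_
      exact ⟨b, by simp [eSupp_single]⟩)
    (cl1 _ _ (by omega) (by omega) hab) (cl1 _ _ (by omega) (by omega) hbc)
  have hmem : s(a, c) ∈ clique (eSupp {s(a, b)} ∪ eSupp {s(b, c)}) := by
    refine ⟨by simpa using hac, ?_⟩
    intro v hv
    simp only [Sym2.mem_iff] at hv
    rw [eSupp_single, eSupp_single]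
    rcases hv with rfl | rfl <;> simp
  rw [← this, Matroid.restrict_closure_eq _ (by
    rintro x (rfl | rfl) <;> assumption) (cliqueN_sub M n)] at hmem
  exact hmem.1

lemma triangle' (hu : M.Unbounded) (h : M.FamilyOfARM 1) {a b c : ℕ} (hab : a ≠ b) (hbc : b ≠ c)
    (hac : a ≠ c) {X : Set (Sym2 ℕ)} (h1 : s(a, b) ∈ M.M.closure X) (h2 : s(b, c) ∈ M.M.closure X) :
    s(a, c) ∈ M.M.closure X := by
  refine M.M.closure_subset_closure_of_subset_closure ?_ (triangle M hu h hab hbc hac)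
  rintro x (rfl | rfl) <;> assumption

/-- An edge vertex-disjoint from `F` is not in the closure of `F`. -/
lemma disj_notMem (hu : M.Unbounded) (h : M.FamilyOfARM 1) {F : Set (Sym2 ℕ)} (hF : F.Finite) :
    (∀ e ∈ F, ¬ e.IsDiag) → ∀ a b : ℕ, a ≠ b → a ∉ eSupp F → b ∉ eSupp F →
    s(a, b) ∉ M.M.closure F := by
  induction F, hF using Set.Finite.induction_on with
  | empty => intro _ a b hab _ _; exact no_loop M hu _ (by simpa using hab)
  | @insert e s hes hs ih =>
    intro hd a b hab ha hb hmem
    have hs' : IsGraph s := ⟨hs, fun x hx => hd x (Or.inr hx)⟩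
    have ha' : a ∉ eSupp s := fun ⟨x, hx, hv⟩ => ha ⟨x, Or.inr hx, hv⟩
    have hb' : b ∉ eSupp s := fun ⟨x, hx, hv⟩ => hb ⟨x, Or.inr hx, hv⟩
    have hno := ih hs'.2 a b hab ha' hb'
    have hex := Matroid.mem_closure_insert hno hmem
    rw [Set.insert_eq] at hex
    rcases cl_union M h (isGraph_single (by simpa using hab)) hs' (by
      rw [eSupp_single]; rintro v (rfl | rfl) <;> assumption) hex with h1 | h1
    · have := no_parallel M hu (by simpa using hab) h1
      apply ha
      exact ⟨e, Or.inl rfl, by rw [this]; simp⟩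
    · rw [Matroid.closure_insert_eq_of_mem_closure h1] at hmem
      exact hno hmem

lemma eSupp_finite {F : Set (Sym2 ℕ)} (hF : F.Finite) : (eSupp F).Finite := by
  have : eSupp F = ⋃ e ∈ F, {v | v ∈ e} := by
    ext v; simp [eSupp]
  rw [this]
  refine hF.biUnion fun e _ => ?_
  induction e with | h a b =>
  refine (Set.toFinite {a, b}).subset ?_
  intro v hv
  simpa using hv

lemma pendant_notMem (hu : M.Unbounded) (h : M.FamilyOfARM 1) {F : Set (Sym2 ℕ)} (hF : IsGraph F)
    {u v : ℕ} (huv : u ≠ v) (hv : v ∉ eSupp F) : s(u, v) ∉ M.M.closure F := by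
  intro hmem
  obtain ⟨w, hw⟩ := ((eSupp_finite hF.1).union (Set.toFinite {u, v})).infinite_compl.nonempty
  simp only [mem_compl_iff, mem_union, mem_insert_iff, mem_singleton_iff, not_or] at hw
  obtain ⟨hwF, hwu, hwv⟩ := hw
  have h1 := closure_perm M (Equiv.swap v w) hmem
  have hfix : Sym2.map (Equiv.swap v w) '' F = F := by
    have : ∀ e ∈ F, Sym2.map (Equiv.swap v w) e = e := by
      intro e he
      suffices hx : ∀ x ∈ e, Equiv.swap v w x = x by
        induction e with | h a b => simp [hx a (by simp), hx b (by simp)]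
      intro x hx
      refine Equiv.swap_apply_of_ne_of_ne ?_ ?_
      · rintro rfl; exact hv ⟨e, he, hx⟩
      · rintro rfl; exact hwF ⟨e, he, hx⟩
    rw [Set.image_congr this]; simp
  rw [hfix, Sym2.map_mk, Equiv.swap_apply_left,
    Equiv.swap_apply_of_ne_of_ne huv (Ne.symm hwu)] at h1
  rw [Sym2.eq_swap] at hmem
  exact disj_notMem M hu h hF.1 hF.2 v w (Ne.symm hwv) hv hwF
    (triangle' M hu h huv.symm (Ne.symm hwu) (Ne.symm hwv) hmem h1)

lemma mem_closure_iff (hu : M.Unbounded) (h : M.FamilyOfARM 1) {E : Set (Sym2 ℕ)} (hE : IsGraph E)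
    {u v : ℕ} (huv : u ≠ v) :
    s(u, v) ∈ M.M.closure E ↔ (SimpleGraph.fromEdgeSet E).Reachable u v := by
  constructor
  · intro hmem
    by_contra hr
    set R : Set ℕ := {x | (SimpleGraph.fromEdgeSet E).Reachable u x} with hR
    set E₁ : Set (Sym2 ℕ) := {e ∈ E | ∀ x ∈ e, x ∈ R}
    set E₂ : Set (Sym2 ℕ) := {e ∈ E | ∀ x ∈ e, x ∉ R}
    have hEE : E = E₁ ∪ E₂ := by
      ext e
      constructor
      · intro he
        induction e with | h a b =>
        have hab : a ≠ b := by simpa using hE.2 _ he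
        have hadj : (SimpleGraph.fromEdgeSet E).Adj a b := by
          rw [SimpleGraph.fromEdgeSet_adj]; exact ⟨he, hab⟩
        by_cases ha : a ∈ R
        · left
          refine ⟨he, ?_⟩
          have hb : b ∈ R := SimpleGraph.Reachable.trans ha hadj.reachable
          intro x hx
          rcases Sym2.mem_iff.1 hx with rfl | rfl <;> assumption
        · right
          refine ⟨he, ?_⟩
          have hb : b ∉ R := fun hb => ha (SimpleGraph.Reachable.trans hb hadj.symm.reachable)
          intro x hx
          rcases Sym2.mem_iff.1 hx with rfl | rfl <;> assumption
      · rintro (h | h) <;> exact h.1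
    have h1 : IsGraph E₁ := isGraph_sub hE fun e he => he.1
    have h2 : IsGraph E₂ := isGraph_sub hE fun e he => he.1
    rw [hEE] at hmem
    rcases cl_union M h h1 h2 (by
      rintro x ⟨e, he, hx⟩ ⟨f, hf, hx'⟩
      exact hf.2 x hx' (he.2 x hx)) hmem with hm | hm
    · refine pendant_notMem M hu h h1 huv ?_ hm
      rintro ⟨e, he, hx⟩
      exact hr (he.2 v hx)
    · rw [Sym2.eq_swap] at hm
      refine pendant_notMem M hu h h2 huv.symm ?_ hm
      rintro ⟨e, he, hx⟩
      exact he.2 u hx (SimpleGraph.Reachable.refl u)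
  · rintro ⟨p⟩
    induction p with
    | nil => exact absurd rfl huv
    | @cons a b c hadj p ih =>
      rw [SimpleGraph.fromEdgeSet_adj] at hadj
      have h1 : s(a, b) ∈ M.M.closure E := M.M.mem_closure_of_mem hadj.1 (graph_sub M hE)
      by_cases hbc : b = c
      · subst hbc; exact h1
      · exact triangle' M hu h hadj.2 hbc huv h1 (ih hbc)

lemma indep_iff (hu : M.Unbounded) (h : M.FamilyOfARM 1) {G : Set (Sym2 ℕ)} (hG : IsGraph G) :
    M.Indep G ↔ IsForest G := by
  unfold GraphMatroidFamily.Indep IsForest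
  rw [Matroid.indep_iff_forall_notMem_closure_sdiff (graph_sub M hG),
    SimpleGraph.isAcyclic_iff_forall_isBridge]
  have hset : (SimpleGraph.fromEdgeSet G).edgeSet = G := by
    rw [SimpleGraph.edgeSet_fromEdgeSet]
    ext e; constructor
    · exact fun he => he.1
    · exact fun he => ⟨he, hG.2 e he⟩
  rw [hset]
  refine forall_congr' fun e => forall_congr' fun he => ?_
  have hd := hG.2 e he
  induction e with | h a b =>
  rw [SimpleGraph.isBridge_iff, mem_closure_iff M hu h (isGraph_sub hG sdiff_subset)
    (by simpa using hd), SimpleGraph.deleteEdges, SimpleGraph.fromEdgeSet_sdiff]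

lemma cycle_of_not_forest {G : Set (Sym2 ℕ)} (hG : ¬ IsForest G) : ∃ D ⊆ G, IsCycleGraph D := by
  unfold IsForest at hG
  rw [SimpleGraph.isAcyclic_iff_free_cycleGraph] at hG
  push Not at hG
  obtain ⟨n, hn, ⟨φ⟩⟩ := hG
  obtain ⟨m, rfl⟩ : ∃ m, n = m + 2 := ⟨n - 2, by omega⟩
  let f : ZMod (m + 2) → ℕ := fun i => φ.toHom (show Fin (m + 2) from i)
  refine ⟨{e : Sym2 ℕ | ∃ i : ZMod (m + 2), e = s(f i, f (i + 1))}, ?_, m + 2, hn, f,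
    φ.injective', rfl⟩
  rintro e ⟨i, rfl⟩
  have key : ∀ a : Fin (m + 2), (SimpleGraph.cycleGraph (m + 2)).Adj a (a + 1) := by
    intro a
    rw [SimpleGraph.cycleGraph_adj]; right; simp
  have := φ.toHom.map_adj (key i)
  rw [SimpleGraph.fromEdgeSet_adj] at this
  exact this.1

lemma cycle_not_forest {C : Set (Sym2 ℕ)} (hC : IsCycleGraph C) : ¬ IsForest C := by
  unfold IsForest
  rw [SimpleGraph.isAcyclic_iff_free_cycleGraph]
  push Not
  obtain ⟨n, hn, f, hf, rfl⟩ := hC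
  refine ⟨n, hn, ?_⟩
  obtain ⟨m, rfl⟩ : ∃ m, n = m + 2 := ⟨n - 2, by omega⟩
  have key : ∀ a b : Fin (m + 2), (SimpleGraph.cycleGraph (m + 2)).Adj a b →
    (SimpleGraph.fromEdgeSet {e : Sym2 ℕ | ∃ i : ZMod (m + 2), e = s(f i, f (i + 1))}).Adj
      (f a) (f b) := by
    intro a b hab
    rw [SimpleGraph.fromEdgeSet_adj]
    refine ⟨?_, fun h => hab.ne (hf h)⟩
    rw [SimpleGraph.cycleGraph_adj] at hab
    rcases hab with hab | hab
    · refine ⟨b, ?_⟩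
      rw [Sym2.eq_swap]
      have : a = b + 1 := by rw [← hab]; abel
      rw [this]; rfl
    · refine ⟨a, ?_⟩
      have : b = a + 1 := by rw [← hab]; abel
      rw [this]; rfl
  exact ⟨⟨⟨fun i => f i, fun {a b} hab => key a b hab⟩, hf⟩⟩

lemma zmod_facts {n : ℕ} (hn : 3 ≤ n) : (1 : ZMod n) ≠ 0 ∧ (2 : ZMod n) ≠ 0 := by
  constructor
  · intro h
    have : ((1 : ℕ) : ZMod n) = 0 := by simpa using h
    rw [ZMod.natCast_eq_zero_iff] at this
    have := Nat.le_of_dvd (by omega) this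
    omega
  · intro h
    have : ((2 : ℕ) : ZMod n) = 0 := by simpa using h
    rw [ZMod.natCast_eq_zero_iff] at this
    have := Nat.le_of_dvd (by omega) this
    omega

lemma cycle_sub_eq {C D : Set (Sym2 ℕ)} (hC : IsCycleGraph C) (hD : IsCycleGraph D) (hDC : D ⊆ C) :
    C ⊆ D := by
  obtain ⟨n, hn, f, hf, rfl⟩ := hC
  obtain ⟨m, hm, g, hg, rfl⟩ := hD
  obtain ⟨hm1, hm2⟩ := zmod_facts hm
  have nb : ∀ (k : ZMod n) (y : ℕ), s(f k, y) ∈ {e : Sym2 ℕ | ∃ i : ZMod n, e = s(f i, f (i + 1))} →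
      y = f (k + 1) ∨ y = f (k - 1) := by
    rintro k y ⟨i, hi⟩
    rw [Sym2.eq_iff] at hi
    rcases hi with ⟨h1, h2⟩ | ⟨h1, h2⟩
    · left; rw [hf h1, h2]
    · right; rw [hf h1, h2]; simp
  have step : ∀ (k : ZMod n), f k ∈ range g →
      s(f k, f (k + 1)) ∈ {e : Sym2 ℕ | ∃ i : ZMod m, e = s(g i, g (i + 1))} ∧
      f (k + 1) ∈ range g := by
    rintro k ⟨j, hj⟩
    have d1 : s(f k, g (j + 1)) ∈ {e : Sym2 ℕ | ∃ i : ZMod m, e = s(g i, g (i + 1))} :=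
      ⟨j, by rw [hj]⟩
    have d2 : s(f k, g (j - 1)) ∈ {e : Sym2 ℕ | ∃ i : ZMod m, e = s(g i, g (i + 1))} :=
      ⟨j - 1, by rw [sub_add_cancel, hj, Sym2.eq_swap]⟩
    have hne : g (j + 1) ≠ g (j - 1) := by
      intro h
      have h' := hg h
      apply hm2
      linear_combination h'
    rcases nb k _ (hDC d1) with h1 | h1
    · rw [h1] at d1; exact ⟨d1, _, h1⟩
    · rcases nb k _ (hDC d2) with h2 | h2
      · rw [h2] at d2; exact ⟨d2, _, h2⟩
      · exact absurd (h1.trans h2.symm) hne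
  obtain ⟨k0, hk0⟩ : ∃ k0, f k0 ∈ range g := by
    obtain ⟨i, hi⟩ := hDC ⟨(0 : ZMod m), rfl⟩
    rw [Sym2.eq_iff] at hi
    rcases hi with ⟨h1, _⟩ | ⟨h1, _⟩
    · exact ⟨i, _, h1⟩
    · exact ⟨i + 1, _, h1⟩
  have all : ∀ t : ℕ, f (k0 + t) ∈ range g := by
    intro t
    induction t with
    | zero => simpa using hk0
    | succ t ih =>
      have := (step _ ih).2
      push_cast
      rwa [← add_assoc]
  have : NeZero n := ⟨by omega⟩
  rintro e ⟨i, rfl⟩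
  have := all (i - k0).val
  rw [ZMod.natCast_zmod_val, add_sub_cancel] at this
  exact (step i this).1

lemma cycle_isGraph {C : Set (Sym2 ℕ)} (hC : IsCycleGraph C) : IsGraph C := by
  obtain ⟨n, hn, f, hf, rfl⟩ := hC
  have : NeZero n := ⟨by omega⟩
  constructor
  · refine (Set.finite_range fun i : ZMod n => s(f i, f (i + 1))).subset ?_
    rintro e ⟨i, rfl⟩
    exact ⟨i, rfl⟩
  · rintro e ⟨i, rfl⟩
    simp only [Sym2.mk_isDiag_iff]
    intro h
    have := hf h
    exact (zmod_facts hn).1 (by linear_combination -this)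

lemma forest_anti {E F : Set (Sym2 ℕ)} (h : E ⊆ F) (hF : IsForest F) : IsForest E :=
  SimpleGraph.IsAcyclic.anti (SimpleGraph.fromEdgeSet_mono h) hF

end OneDimProof

/-- If `M` is an unbounded, nontrivial graph matroid family that is a
family of `1`-dimensional abstract rigidity matroids, then the `M`-circuits are exactly
the cycle graphs `C_n`, `n ≥ 3`; consequently `M` is the family of graphic matroids:
a graph is `M`-independent if and only if it is a forest. -/
theorem one_dim_arm_is_graphic (M : GraphMatroidFamily)
    (hu : M.Unbounded) (hnt : ¬ M.Trivial) (h : M.FamilyOfARM 1) :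
    (∀ C : Set (Sym2 ℕ), M.IsCircuit C ↔ IsCycleGraph C) ∧
    (∀ G : Set (Sym2 ℕ), IsGraph G → (M.Indep G ↔ IsForest G)) := by
  open OneDimProof in
  refine ⟨fun C => ⟨?_, ?_⟩, fun G hG => indep_iff M hu h hG⟩
  · rintro ⟨hg, hnot, hmin⟩
    rw [indep_iff M hu h hg] at hnot
    obtain ⟨D, hDC, hD⟩ := cycle_of_not_forest hnot
    have : C = D := by
      refine Set.Subset.antisymm ?_ hDC
      intro e he
      by_contra heD
      have h1 := hmin e he
      rw [indep_iff M hu h (isGraph_sub hg Set.sdiff_subset)] at h1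
      refine cycle_not_forest hD (forest_anti ?_ h1)
      intro x hx
      refine ⟨hDC hx, ?_⟩
      rintro rfl
      exact heD hx
    rw [this]; exact hD
  · intro hC
    have hg := cycle_isGraph hC
    refine ⟨hg, ?_, ?_⟩
    · rw [indep_iff M hu h hg]; exact cycle_not_forest hC
    · intro e he
      rw [indep_iff M hu h (isGraph_sub hg Set.sdiff_subset)]
      by_contra hnf
      obtain ⟨D, hDC, hD⟩ := cycle_of_not_forest hnf
      have h2 := cycle_sub_eq hC hD (hDC.trans Set.sdiff_subset) he
      exact (hDC h2).2 rfl
end
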